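/- (Comparison principle under full controllability.) Let u : S → ℝ be a bounded continuous viscosity subsolution of the Hamilton–Jacobi equation λu(x) + sup_{(ζ,ξ)∈FL(x)}{−Du(x,ζ) − ξ} = 0 in S, and let v : S → ℝ be a bounded lower semicontinuous viscosity supersolution of the same equation. Then u ≤ v on S. -/

import Mathlib

open scoped RealInnerProductSpace
open Set Metric MeasureTheory

noncomputable section

abbrev E3 : Type := EuclideanSpace ℝ (Fin 3)

/-- The closed half-plane `ℝ e0 × ℝ₊ ei`. -/
def halfPlane (e0 ei : E3) : Set E3 :=
  {x | ∃ x0 xi : ℝ, 0 ≤ xi ∧ x = x0 • e0 + xi • ei}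

/-- The interface `Γ = ℝ e0`. -/
def iface (e0 : E3) : Set E3 := {x | ∃ t : ℝ, x = t • e0}

/-- The junction `S = ⋃ i Pᵢ`. -/
def junction (N : ℕ) (e0 : E3) (e : Fin N → E3) : Set E3 :=
  ⋃ i, halfPlane e0 (e i)

/-- Admissible test functions on the junction: continuous on `S`, `C¹` on each
half-plane `Pᵢ`, with `Dφ i x ∈ ℝ e0 + ℝ eᵢ` the gradient of `φ|_{Pᵢ}`. -/
structure TestFun (N : ℕ) (e0 : E3) (e : Fin N → E3) where
  φ : E3 → ℝ
  Dφ : Fin N → E3 → E3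
  cont : ContinuousOn φ (junction N e0 e)
  dphi_plane : ∀ i, ∀ x ∈ halfPlane e0 (e i), ∃ c0 ci : ℝ, Dφ i x = c0 • e0 + ci • e i
  hasDeriv : ∀ i, ∀ x ∈ halfPlane e0 (e i),
    HasFDerivWithinAt φ (innerSL ℝ (Dφ i x)) (halfPlane e0 (e i)) x
  contDeriv : ∀ i, ContinuousOn (Dφ i) (halfPlane e0 (e i))

/-- Viscosity subsolution of `λ u(x) + sup_{(ζ,ξ) ∈ FL(x)} {-Du(x,ζ) - ξ} = 0` on `S`,
where `FL(x) = FLᵢ(x)` if `x ∈ Pᵢ \ Γ` and `FL(x) = ⋃ᵢ FLᵢ⁺(x)` if `x ∈ Γ`. -/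
def IsSubSol (N : ℕ) (e0 : E3) (e : Fin N → E3) {A : Type} [MetricSpace A]
    (Ai : Fin N → Set A) (f : Fin N → E3 → A → E3) (ℓ : Fin N → E3 → A → ℝ)
    (lam : ℝ) (u : E3 → ℝ) : Prop :=
  ∀ x ∈ junction N e0 e, ∀ ψ : TestFun N e0 e,
    IsLocalMaxOn (fun y => u y - ψ.φ y) (junction N e0 e) x →
    ∀ i, x ∈ halfPlane e0 (e i) → ∀ a ∈ Ai i,
      (x ∉ iface e0 ∨ 0 ≤ ⟪f i x a, e i⟫) →
      lam * u x - ⟪ψ.Dφ i x, f i x a⟫ - ℓ i x a ≤ 0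

/-- Viscosity supersolution of the same Hamilton-Jacobi equation on `S`. -/
def IsSuperSol (N : ℕ) (e0 : E3) (e : Fin N → E3) {A : Type} [MetricSpace A]
    (Ai : Fin N → Set A) (f : Fin N → E3 → A → E3) (ℓ : Fin N → E3 → A → ℝ)
    (lam : ℝ) (v : E3 → ℝ) : Prop :=
  ∀ x ∈ junction N e0 e, ∀ ψ : TestFun N e0 e,
    IsLocalMinOn (fun y => v y - ψ.φ y) (junction N e0 e) x →
    ∃ i, x ∈ halfPlane e0 (e i) ∧ ∃ a ∈ Ai i,
      (x ∉ iface e0 ∨ 0 ≤ ⟪f i x a, e i⟫) ∧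
      0 ≤ lam * v x - ⟪ψ.Dφ i x, f i x a⟫ - ℓ i x a

open Filter Topology

lemma exists_penalization_bound {X : Type*} [TopologicalSpace X] {K : Set X} (hK : IsCompact K)
    {F G : X → ℝ} (hF : UpperSemicontinuous F) (hG : Continuous G) {m : ℝ}
    (hG0 : ∀ z ∈ K, 0 ≤ G z) (hm : ∀ z ∈ K, G z = 0 → F z ≤ m) {ε : ℝ} (hε : 0 < ε) :
    ∃ α₀ : ℝ, ∀ α ≥ α₀, ∀ z ∈ K, m ≤ F z - α * G z → F z < m + ε := by
  have hK' : IsCompact (K ∩ F ⁻¹' Ici (m + ε)) := hK.inter_right (hF.isClosed_preimage _)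
  rcases (K ∩ F ⁻¹' Ici (m + ε)).eq_empty_or_nonempty with hem | hne
  · refine ⟨0, fun α _ z hz _ => ?_⟩
    by_contra hcon
    have : z ∈ K ∩ F ⁻¹' Ici (m + ε) := ⟨hz, not_lt.mp hcon⟩
    simp [hem] at this
  · obtain ⟨z₀, hz₀, hmin⟩ := hK'.exists_isMinOn hne hG.continuousOn
    obtain ⟨z₁, hz₁, hmax⟩ := hF.upperSemicontinuousOn K |>.exists_isMaxOn ⟨z₀, hz₀.1⟩ hK
    have hpos : 0 < G z₀ := by
      refine lt_of_le_of_ne (hG0 _ hz₀.1) fun h => ?_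
      have h1 := hm z₀ hz₀.1 h.symm
      have h2 : m + ε ≤ F z₀ := hz₀.2
      linarith
    refine ⟨max 0 ((F z₁ - m) / G z₀ + 1), fun α hα z hz hle => ?_⟩
    by_contra hcon
    have hz' : z ∈ K ∩ F ⁻¹' Ici (m + ε) := ⟨hz, not_lt.mp hcon⟩
    have h1 : G z₀ ≤ G z := hmin hz'
    have h2 : F z ≤ F z₁ := hmax hz
    have h3 : (F z₁ - m) / G z₀ + 1 ≤ α := (le_max_right _ _).trans hα
    have h4 : 0 ≤ α := (le_max_left _ _).trans hα
    have h5 : α * G z₀ ≤ α * G z := mul_le_mul_of_nonneg_left h1 h4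
    have h6 : ((F z₁ - m) / G z₀ + 1) * G z₀ ≤ α * G z₀ := mul_le_mul_of_nonneg_right h3 hpos.le
    rw [add_mul, div_mul_cancel₀ _ hpos.ne'] at h6
    linarith

/-- The graph of `W` is touched from above at `(s, t)`, relative to `{t ≥ 0}`, by a paraboloid
with gradient `(p, q)` and opening `C`. -/
def TouchAbove (W : ℝ → ℝ → ℝ) (s t p q C : ℝ) : Prop :=
  ∀ᶠ z : ℝ × ℝ in 𝓝 (s, t), 0 ≤ z.2 →
    W z.1 z.2 ≤ W s t + p * (z.1 - s) + q * (z.2 - t) + C * ((z.1 - s) ^ 2 + (z.2 - t) ^ 2)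

/-- The graph of `W` is touched from below at `(s, t)`, relative to `{t ≥ 0}`, by a paraboloid
with gradient `(p, q)` and opening `-C`. -/
def TouchBelow (W : ℝ → ℝ → ℝ) (s t p q C : ℝ) : Prop :=
  ∀ᶠ z : ℝ × ℝ in 𝓝 (s, t), 0 ≤ z.2 →
    W s t + p * (z.1 - s) + q * (z.2 - t) - C * ((z.1 - s) ^ 2 + (z.2 - t) ^ 2) ≤ W z.1 z.2

/-- A subsolution `U` (up to an error `c₀`) and a supersolution `V` of the Hamilton-Jacobi equation
on the junction, written branch by branch in the coordinates `(s, t)` along and away from the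
interface. -/
structure CoordProblem {N : ℕ} {A : Type} (Ai : Fin N → Set A) (b c l : Fin N → ℝ → ℝ → A → ℝ)
    (lam c₀ Mf L : ℝ) (U V : Fin N → ℝ → ℝ → ℝ) : Prop where
  lam_pos : 0 < lam
  Mf_nonneg : 0 ≤ Mf
  L_nonneg : 0 ≤ L
  U_cont : ∀ i, Continuous fun z : ℝ × ℝ => U i z.1 z.2
  V_lsc : ∀ i, LowerSemicontinuous fun z : ℝ × ℝ => V i z.1 z.2
  U_glue : ∀ i j s, U i s 0 = U j s 0
  V_glue : ∀ i j s, V i s 0 = V j s 0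
  b_bdd : ∀ i s t, 0 ≤ t → ∀ a ∈ Ai i, |b i s t a| ≤ Mf
  c_bdd : ∀ i s t, 0 ≤ t → ∀ a ∈ Ai i, |c i s t a| ≤ Mf
  b_lip : ∀ i s t s' t', 0 ≤ t → 0 ≤ t' → ∀ a ∈ Ai i,
    |b i s t a - b i s' t' a| ≤ L * (|s - s'| + |t - t'|)
  c_lip : ∀ i s t s' t', 0 ≤ t → 0 ≤ t' → ∀ a ∈ Ai i,
    |c i s t a - c i s' t' a| ≤ L * (|s - s'| + |t - t'|)
  l_unif : ∀ R η : ℝ, 0 < η → ∃ d > 0, ∀ i s t s' t', |s| ≤ R → |s'| ≤ R → 0 ≤ t → t ≤ R →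
    0 ≤ t' → t' ≤ R → |s - s'| < d → |t - t'| < d → ∀ a ∈ Ai i, |l i s t a - l i s' t' a| ≤ η
  sub_int : ∀ i s t, 0 < t → ∀ p q C, TouchAbove (U i) s t p q C → ∀ a ∈ Ai i,
    lam * U i s t - p * b i s t a - q * c i s t a - l i s t a ≤ c₀
  super_int : ∀ i s t, 0 < t → ∀ p q C, TouchBelow (V i) s t p q C → ∃ a ∈ Ai i,
    0 ≤ lam * V i s t - p * b i s t a - q * c i s t a - l i s t a
  super_iface : ∀ s p (q : Fin N → ℝ) C, (∀ j, TouchBelow (V j) s 0 p (q j) C) →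
    ∃ j, ∃ a ∈ Ai j, 0 ≤ lam * V j s 0 - p * b j s 0 a - q j * c j s 0 a - l j s 0 a

namespace CoordProblem

variable {N : ℕ} {A : Type} {Ai : Fin N → Set A} {b c l : Fin N → ℝ → ℝ → A → ℝ}
  {lam c₀ Mf L : ℝ} {U V : Fin N → ℝ → ℝ → ℝ}

lemma usc_diff (h : CoordProblem Ai b c l lam c₀ Mf L U V) (i : Fin N) {X : Type*}
    [TopologicalSpace X] {x y : X → ℝ × ℝ} (hx : Continuous x) (hy : Continuous y) {P : X → ℝ}
    (hP : Continuous P) :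
    UpperSemicontinuous fun z => U i (x z).1 (x z).2 - V i (y z).1 (y z).2 - P z := by
  intro z r hr
  dsimp only at hr
  have hgap : 0 < r - (U i (x z).1 (x z).2 - V i (y z).1 (y z).2 - P z) := by linarith
  set g := r - (U i (x z).1 (x z).2 - V i (y z).1 (y z).2 - P z) with hg
  have h1 : ∀ᶠ w in 𝓝 z, V i (y z).1 (y z).2 - g / 3 < V i (y w).1 (y w).2 :=
    (h.V_lsc i).comp hy z _ (by dsimp only [Function.comp]; linarith)
  have h2 : ∀ᶠ w in 𝓝 z, U i (x w).1 (x w).2 < U i (x z).1 (x z).2 + g / 3 :=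
    ((h.U_cont i).comp hx).continuousAt.eventually_lt_const (by dsimp only [Function.comp]; linarith)
  have h3 : ∀ᶠ w in 𝓝 z, P z - g / 3 < P w :=
    hP.continuousAt.eventually_const_lt (by linarith)
  filter_upwards [h1, h2, h3] with w h1 h2 h3
  linarith

/-- The viscosity inequalities at an interior maximum of the function with doubled variables. -/
lemma doubled_inequality (h : CoordProblem Ai b c l lam c₀ Mf L U V) {i : Fin N}
    {s t s' t' α γ β s₀ s₁ t₁ s₂ κ : ℝ} (ht : 0 < t) (ht' : 0 < t')
    (hloc : ∀ᶠ z : (ℝ × ℝ) × (ℝ × ℝ) in 𝓝 ((s, t), (s', t')),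
      U i z.1.1 z.1.2 - V i z.2.1 z.2.2 - (α * (z.1.1 - z.2.1) ^ 2 + γ * (z.1.2 - z.2.2) ^ 2 +
        β * ((z.1.1 - s₀) ^ 2 + z.1.2 ^ 2) + (z.1.1 - s₁) ^ 2 + (z.1.2 - t₁) ^ 2 +
        κ * (z.2.1 - s₂) ^ 2) ≤
      U i s t - V i s' t' - (α * (s - s') ^ 2 + γ * (t - t') ^ 2 +
        β * ((s - s₀) ^ 2 + t ^ 2) + (s - s₁) ^ 2 + (t - t₁) ^ 2 + κ * (s' - s₂) ^ 2)) :
    ∃ a ∈ Ai i, lam * (U i s t - V i s' t') ≤ c₀ +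
      (2 * α * (s - s') * (b i s t a - b i s' t' a) + 2 * γ * (t - t') * (c i s t a - c i s' t' a) +
      (2 * β * (s - s₀) + 2 * (s - s₁)) * b i s t a + (2 * β * t + 2 * (t - t₁)) * c i s t a +
      2 * κ * (s' - s₂) * b i s' t' a + (l i s t a - l i s' t' a)) := by
  have hsub : TouchAbove (U i) s t (2 * α * (s - s') + 2 * β * (s - s₀) + 2 * (s - s₁))
      (2 * γ * (t - t') + 2 * β * t + 2 * (t - t₁)) (|α| + |γ| + |β| + 1) := by
    have hc : Tendsto (fun x : ℝ × ℝ => (x, (s', t'))) (𝓝 (s, t)) (𝓝 ((s, t), (s', t'))) :=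
      (Continuous.prodMk_left (s', t')).continuousAt
    filter_upwards [hc.eventually hloc] with x hx _
    have e1 := mul_le_mul_of_nonneg_right (le_abs_self α) (sq_nonneg (x.1 - s))
    have e2 := mul_le_mul_of_nonneg_right (le_abs_self γ) (sq_nonneg (x.2 - t))
    have e3 := mul_le_mul_of_nonneg_right (le_abs_self β) (sq_nonneg (x.1 - s))
    have e4 := mul_le_mul_of_nonneg_right (le_abs_self β) (sq_nonneg (x.2 - t))
    have e5 := mul_nonneg (abs_nonneg α) (sq_nonneg (x.2 - t))
    have e6 := mul_nonneg (abs_nonneg γ) (sq_nonneg (x.1 - s))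
    linarith
  have hsup : TouchBelow (V i) s' t' (2 * α * (s - s') - 2 * κ * (s' - s₂)) (2 * γ * (t - t'))
      (|α| + |γ| + |κ|) := by
    have hc : Tendsto (fun x : ℝ × ℝ => ((s, t), x)) (𝓝 (s', t')) (𝓝 ((s, t), (s', t'))) :=
      (Continuous.prodMk_right (s, t)).continuousAt
    filter_upwards [hc.eventually hloc] with x hx _
    have e1 := mul_le_mul_of_nonneg_right (le_abs_self α) (sq_nonneg (x.1 - s'))
    have e2 := mul_le_mul_of_nonneg_right (le_abs_self γ) (sq_nonneg (x.2 - t'))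
    have e3 := mul_le_mul_of_nonneg_right (le_abs_self κ) (sq_nonneg (x.1 - s'))
    have e4 := mul_nonneg (abs_nonneg κ) (sq_nonneg (x.2 - t'))
    have e5 := mul_nonneg (abs_nonneg α) (sq_nonneg (x.2 - t'))
    have e6 := mul_nonneg (abs_nonneg γ) (sq_nonneg (x.1 - s'))
    linarith
  obtain ⟨a, ha, h2⟩ := h.super_int i s' t' ht' _ _ _ hsup
  have h1 := h.sub_int i s t ht _ _ _ hsub a ha
  exact ⟨a, ha, by linarith⟩

end CoordProblem

lemma exists_small_mul_le {C η r : ℝ} (hC : 0 ≤ C) (hη : 0 < η) (hr : 0 < r) :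
    ∃ e > 0, e ≤ r ∧ C * e ≤ η := by
  refine ⟨min r (η / (C + 1)), by positivity, min_le_left _ _, ?_⟩
  calc C * min r (η / (C + 1)) ≤ (C + 1) * (η / (C + 1)) := by
        gcongr
        · linarith
        · exact min_le_right _ _
    _ = η := mul_div_cancel₀ _ (by positivity)

namespace CoordProblem

variable {N : ℕ} {A : Type} {Ai : Fin N → Set A} {b c l : Fin N → ℝ → ℝ → A → ℝ}
  {lam c₀ Mf L : ℝ} {U V : Fin N → ℝ → ℝ → ℝ}

/-- The difference of the two solutions at a global maximum point off the interface. -/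
lemma le_of_isMax_interior (h : CoordProblem Ai b c l lam c₀ Mf L U V) {i : Fin N} {s₀ t₀ : ℝ}
    (ht₀ : 0 < t₀) (hmax : ∀ s t, 0 ≤ t → U i s t - V i s t ≤ U i s₀ t₀ - V i s₀ t₀) :
    lam * (U i s₀ t₀ - V i s₀ t₀) ≤ c₀ := by
  refine le_of_forall_pos_le_add fun η hη => ?_
  obtain ⟨d, hd, hl⟩ := h.l_unif (|s₀| + t₀ + 1) (η / 2) (by positivity)
  have hL := h.L_nonneg
  have hM := h.Mf_nonneg
  have hlam := h.lam_pos
  obtain ⟨e, he, her, heη⟩ := exists_small_mul_le (C := 4 * L + 4 * Mf) (η := η / 2)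
    (r := min (1 / 4) (min (t₀ / 8) (d / 2))) (by positivity) (by positivity) (by positivity)
  obtain ⟨he1, het, hed⟩ : e ≤ 1 / 4 ∧ e ≤ t₀ / 8 ∧ e ≤ d / 2 := by
    simpa only [le_min_iff] using her
  set M := U i s₀ t₀ - V i s₀ t₀ with hMdef
  set K : Set ((ℝ × ℝ) × (ℝ × ℝ)) := closedBall ((s₀, t₀), (s₀, t₀)) (4 * e) with hKdef
  have hKmem : ∀ z ∈ K, (|z.1.1 - s₀| ≤ 4 * e ∧ |z.1.2 - t₀| ≤ 4 * e) ∧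
      |z.2.1 - s₀| ≤ 4 * e ∧ |z.2.2 - t₀| ≤ 4 * e := by
    intro z hz
    simpa [hKdef, Prod.dist_eq, Real.dist_eq] using hz
  have hK : IsCompact K := isCompact_closedBall _ _
  have hF := h.usc_diff i (X := (ℝ × ℝ) × (ℝ × ℝ)) continuous_fst continuous_snd
    (P := fun _ => 0) continuous_const
  obtain ⟨α₀, hα₀⟩ := exists_penalization_bound hK hF
    (G := fun z => (z.1.1 - z.2.1) ^ 2 + (z.1.2 - z.2.2) ^ 2) (by fun_prop) (m := M)
    (fun z _ => by positivity)
    (fun z hz h0 => by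
      have hb := hKmem z hz
      have h1 : z.1.1 = z.2.1 := by nlinarith [sq_nonneg (z.1.1 - z.2.1), sq_nonneg (z.1.2 - z.2.2)]
      have h2 : z.1.2 = z.2.2 := by nlinarith [sq_nonneg (z.1.1 - z.2.1), sq_nonneg (z.1.2 - z.2.2)]
      have h3 := hmax z.2.1 z.2.2 (by have := abs_le.mp hb.2.2; linarith)
      simp only [h1, h2, sub_zero]
      exact h3) (ε := e ^ 2) (by positivity)
  set α := max α₀ 1 with hα
  have hα1 : 1 ≤ α := le_max_right _ _
  set P : (ℝ × ℝ) × (ℝ × ℝ) → ℝ := fun z => α * (z.1.1 - z.2.1) ^ 2 + α * (z.1.2 - z.2.2) ^ 2 +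
        0 * ((z.1.1 - s₀) ^ 2 + z.1.2 ^ 2) + (z.1.1 - s₀) ^ 2 + (z.1.2 - t₀) ^ 2 +
        0 * (z.2.1 - s₀) ^ 2 with hP
  have husc := h.usc_diff i (X := (ℝ × ℝ) × (ℝ × ℝ)) continuous_fst continuous_snd
    (P := P) (by fun_prop)
  have hcen : (((s₀, t₀), (s₀, t₀)) : (ℝ × ℝ) × (ℝ × ℝ)) ∈ K := mem_closedBall_self (by positivity)
  obtain ⟨⟨⟨s, t⟩, ⟨s', t'⟩⟩, hzK, hzmax⟩ := (husc.upperSemicontinuousOn K).exists_isMaxOn ⟨_, hcen⟩ hK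
  have hge : M ≤ U i s t - V i s' t' - P ((s, t), (s', t')) := by
    have := hzmax hcen
    simp only [mem_ofPred_eq] at this
    have h0 : P ((s₀, t₀), (s₀, t₀)) = 0 := by simp [hP]
    rw [h0] at this
    linarith
  have hFlt := hα₀ α (le_max_left _ _) _ hzK (by
    dsimp only
    have : 0 ≤ (s - s₀) ^ 2 + (t - t₀) ^ 2 := by positivity
    simp only [hP] at hge
    linarith)
  dsimp only at hFlt
  have hpen : α * (s - s') ^ 2 + α * (t - t') ^ 2 + (s - s₀) ^ 2 + (t - t₀) ^ 2 < e ^ 2 := by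
    simp only [hP] at hge
    linarith
  have ha1 : (s - s') ^ 2 ≤ α * (s - s') ^ 2 := le_mul_of_one_le_left (sq_nonneg _) hα1
  have ha2 : (t - t') ^ 2 ≤ α * (t - t') ^ 2 := le_mul_of_one_le_left (sq_nonneg _) hα1
  have n1 := sq_nonneg (s - s')
  have n2 := sq_nonneg (t - t')
  have n3 := sq_nonneg (s - s₀)
  have n4 := sq_nonneg (t - t₀)
  have b1 : |s - s'| < e := abs_lt_of_sq_lt_sq (by linarith) he.le
  have b2 : |t - t'| < e := abs_lt_of_sq_lt_sq (by linarith) he.le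
  have b3 : |s - s₀| < e := abs_lt_of_sq_lt_sq (by linarith) he.le
  have b4 : |t - t₀| < e := abs_lt_of_sq_lt_sq (by linarith) he.le
  have b5 : |s' - s₀| < 2 * e := by
    rw [abs_lt] at b1 b3 ⊢; constructor <;> linarith
  have b6 : |t' - t₀| < 2 * e := by
    rw [abs_lt] at b2 b4 ⊢; constructor <;> linarith
  have htpos : 0 < t := by rw [abs_lt] at b4; linarith
  have htpos' : 0 < t' := by rw [abs_lt] at b6; linarith
  have hnhds : K ∈ 𝓝 (((s, t), (s', t')) : (ℝ × ℝ) × (ℝ × ℝ)) := by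
    refine closedBall_mem_nhds_of_mem ?_
    simp only [mem_ball, Prod.dist_eq, Real.dist_eq, max_lt_iff]
    refine ⟨⟨?_, ?_⟩, ?_, ?_⟩ <;> linarith
  obtain ⟨a, ha, hineq⟩ := h.doubled_inequality (i := i) (s := s) (t := t) (s' := s') (t' := t')
    (α := α) (γ := α) (β := 0) (s₀ := s₀) (s₁ := s₀) (t₁ := t₀) (s₂ := s₀) (κ := 0) htpos htpos'
    (by filter_upwards [hnhds] with z hz using hzmax hz)
  have hR : ∀ x, |x - s₀| < 2 * e → |x| ≤ |s₀| + t₀ + 1 := fun x hx => by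
    have := abs_sub_abs_le_abs_sub x s₀
    linarith
  have hll := hl i s t s' t' (hR s (by linarith)) (hR s' b5) htpos.le
    (by rw [abs_lt] at b4; linarith [abs_nonneg s₀]) htpos'.le
    (by rw [abs_lt] at b6; linarith [abs_nonneg s₀]) (by linarith) (by linarith) a ha
  have hbl := h.b_lip i s t s' t' htpos.le htpos'.le a ha
  have hcl := h.c_lip i s t s' t' htpos.le htpos'.le a ha
  have hbb := h.b_bdd i s t htpos.le a ha
  have hcb := h.c_bdd i s t htpos.le a ha
  have hα0 : 0 ≤ α := by linarith
  have T1 : 2 * α * (s - s') * (b i s t a - b i s' t' a) ≤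
      2 * α * |s - s'| * (L * (|s - s'| + |t - t'|)) := by
    refine (le_abs_self _).trans ?_
    rw [abs_mul, abs_mul, abs_of_nonneg (by positivity : 0 ≤ 2 * α)]
    gcongr
  have T2 : 2 * α * (t - t') * (c i s t a - c i s' t' a) ≤
      2 * α * |t - t'| * (L * (|s - s'| + |t - t'|)) := by
    refine (le_abs_self _).trans ?_
    rw [abs_mul, abs_mul, abs_of_nonneg (by positivity : 0 ≤ 2 * α)]
    gcongr
  have T12 : 2 * α * |s - s'| * (L * (|s - s'| + |t - t'|)) +
      2 * α * |t - t'| * (L * (|s - s'| + |t - t'|)) ≤ 4 * L * e := by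
    have e1 : α * (|s - s'| + |t - t'|) ^ 2 ≤ 2 * e := by
      have : (|s - s'| + |t - t'|) ^ 2 ≤ 2 * ((s - s') ^ 2 + (t - t') ^ 2) := by
        have := sq_nonneg (|s - s'| - |t - t'|)
        rw [← sq_abs (s - s'), ← sq_abs (t - t')]
        linarith
      have := mul_le_mul_of_nonneg_left this hα0
      have he2 : e ^ 2 ≤ e := by rw [sq]; exact mul_le_of_le_one_left he.le (by linarith)
      linarith
    have := mul_le_mul_of_nonneg_left e1 hL
    linarith
  have T3 : 2 * (s - s₀) * b i s t a ≤ 2 * e * Mf := by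
    refine (le_abs_self _).trans ?_
    rw [abs_mul, abs_mul, abs_of_nonneg (by positivity : (0:ℝ) ≤ 2)]
    gcongr
  have T4 : 2 * (t - t₀) * c i s t a ≤ 2 * e * Mf := by
    refine (le_abs_self _).trans ?_
    rw [abs_mul, abs_mul, abs_of_nonneg (by positivity : (0:ℝ) ≤ 2)]
    gcongr
  have T5 := (le_abs_self _).trans hll
  have hfin : lam * M ≤ lam * (U i s t - V i s' t') := by
    refine mul_le_mul_of_nonneg_left ?_ hlam.le
    have : 0 ≤ P ((s, t), (s', t')) := by simp only [hP]; positivity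
    linarith
  linarith

/-- The estimate of the difference of the two solutions when the function in which only the
tangential variable is doubled has a maximum off the interface, in the region where the subsolution
is Lipschitz in the normal variable. -/
lemma le_of_isMax_near_iface (h : CoordProblem Ai b c l lam c₀ Mf L U V) {i : Fin N}
    {s₀ σ₁ t₁ σ₂ r α e K d η M : ℝ} (he : 0 < e) (her : 6 * e ≤ r) (hr1 : r ≤ 1) (hα1 : 1 ≤ α)
    (ht₁ : 0 < t₁) (ht₁e : t₁ < e) (hσ₁ : |σ₁ - s₀| < e) (hσ₂ : |σ₂ - s₀| < 2 * e)
    (hσ : α * (σ₁ - σ₂) ^ 2 < e ^ 2) (hK : 0 ≤ K)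
    (hLip : ∀ s t t', 0 ≤ t → t ≤ r → 0 ≤ t' → t' ≤ r → |U i s t - U i s t'| ≤ K * |t - t'|)
    (hd : 3 * e ≤ d)
    (hl : ∀ s t s' t', |s - s₀| ≤ r → |s' - s₀| ≤ r → 0 ≤ t → t ≤ r →
      0 ≤ t' → t' ≤ r → |s - s'| < d → |t - t'| < d → ∀ a ∈ Ai i, |l i s t a - l i s' t' a| ≤ η)
    (hmax : ∀ s t s', |s - s₀| ≤ r → |s' - s₀| ≤ r → 0 ≤ t → t ≤ r →
      U i s t - V i s' t - (α * (s - s') ^ 2 + (s - s₀) ^ 2 + t ^ 2) ≤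
      U i σ₁ t₁ - V i σ₂ t₁ - (α * (σ₁ - σ₂) ^ 2 + (σ₁ - s₀) ^ 2 + t₁ ^ 2))
    (hM : M ≤ U i σ₁ t₁ - V i σ₂ t₁ - (α * (σ₁ - σ₂) ^ 2 + (σ₁ - s₀) ^ 2 + t₁ ^ 2)) :
    lam * M ≤ c₀ + η + (26 * L + 8 * (K + 2) * L + 14 * Mf) * e := by
  have hL := h.L_nonneg
  have hMf := h.Mf_nonneg
  have hlam := h.lam_pos
  have hα0 : 0 ≤ α := by linarith
  obtain ⟨e', he', her', hαe'⟩ := exists_small_mul_le (C := α) (η := e)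
    (r := min e (t₁ / 8)) hα0 he (by positivity)
  obtain ⟨hee, het⟩ : e' ≤ e ∧ e' ≤ t₁ / 8 := by simpa only [le_min_iff] using her'
  set Mα := U i σ₁ t₁ - V i σ₂ t₁ - (α * (σ₁ - σ₂) ^ 2 + (σ₁ - s₀) ^ 2 + t₁ ^ 2) with hMα
  set B : Set ((ℝ × ℝ) × (ℝ × ℝ)) := closedBall ((σ₁, t₁), (σ₂, t₁)) (4 * e') with hBdef
  have hBmem : ∀ z, z ∈ B ↔ (|z.1.1 - σ₁| ≤ 4 * e' ∧ |z.1.2 - t₁| ≤ 4 * e') ∧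
      |z.2.1 - σ₂| ≤ 4 * e' ∧ |z.2.2 - t₁| ≤ 4 * e' := by
    intro z
    simp [hBdef, Prod.dist_eq, Real.dist_eq]
  have hB : IsCompact B := isCompact_closedBall _ _
  rw [abs_lt] at hσ₁ hσ₂
  have hs_box : ∀ s, |s - σ₁| ≤ 4 * e' → |s - s₀| ≤ r := fun s hs => by
    rw [abs_le] at hs ⊢; constructor <;> linarith
  have hs'_box : ∀ s, |s - σ₂| ≤ 4 * e' → |s - s₀| ≤ r := fun s hs => by
    rw [abs_le] at hs ⊢; constructor <;> linarith
  have ht_box : ∀ t, |t - t₁| ≤ 4 * e' → 0 < t ∧ t ≤ r := fun t hs => by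
    rw [abs_le] at hs; constructor <;> linarith
  have hF := h.usc_diff i (X := (ℝ × ℝ) × (ℝ × ℝ)) continuous_fst continuous_snd
    (P := fun z => α * (z.1.1 - z.2.1) ^ 2 + (z.1.1 - s₀) ^ 2 + z.1.2 ^ 2) (by fun_prop)
  obtain ⟨γ₀, hγ₀⟩ := exists_penalization_bound hB hF
    (G := fun z => (z.1.2 - z.2.2) ^ 2) (by fun_prop) (m := Mα)
    (fun z _ => by positivity)
    (fun z hz h0 => by
      have hb := (hBmem z).1 hz
      have h2 : z.2.2 = z.1.2 := by
        have := pow_eq_zero_iff (two_ne_zero) |>.1 h0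
        linarith
      have h3 := hmax z.1.1 z.1.2 z.2.1 (hs_box _ hb.1.1) (hs'_box _ hb.2.1)
        (ht_box _ hb.1.2).1.le (ht_box _ hb.1.2).2
      simp only [h2]
      exact h3) (ε := e' ^ 2) (by positivity)
  set γ := max γ₀ 1 with hγ
  have hγ1 : 1 ≤ γ := le_max_right _ _
  have hγ0 : 0 ≤ γ := by linarith
  set P : (ℝ × ℝ) × (ℝ × ℝ) → ℝ := fun z => α * (z.1.1 - z.2.1) ^ 2 + γ * (z.1.2 - z.2.2) ^ 2 +
        1 * ((z.1.1 - s₀) ^ 2 + z.1.2 ^ 2) + (z.1.1 - σ₁) ^ 2 + (z.1.2 - t₁) ^ 2 +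
        1 * (z.2.1 - σ₂) ^ 2 with hP
  have husc := h.usc_diff i (X := (ℝ × ℝ) × (ℝ × ℝ)) continuous_fst continuous_snd
    (P := P) (by fun_prop)
  have hcen : (((σ₁, t₁), (σ₂, t₁)) : (ℝ × ℝ) × (ℝ × ℝ)) ∈ B := mem_closedBall_self (by positivity)
  obtain ⟨⟨⟨s, t⟩, ⟨s', t'⟩⟩, hzB, hzmax⟩ := (husc.upperSemicontinuousOn B).exists_isMaxOn ⟨_, hcen⟩ hB
  have hge : Mα ≤ U i s t - V i s' t' - P ((s, t), (s', t')) := by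
    have := hzmax hcen
    simp only [mem_ofPred_eq] at this
    have h0 : P ((σ₁, t₁), (σ₂, t₁)) = α * (σ₁ - σ₂) ^ 2 + (σ₁ - s₀) ^ 2 + t₁ ^ 2 := by
      simp only [hP]; ring
    rw [h0] at this
    exact this
  have hmM : lam * M ≤ lam * (U i s t - V i s' t') := by
    refine mul_le_mul_of_nonneg_left ?_ hlam.le
    have : 0 ≤ P ((s, t), (s', t')) := by simp only [hP]; positivity
    linarith
  have hFlt := hγ₀ γ (le_max_left _ _) _ hzB (by
    dsimp only
    have : 0 ≤ (s - σ₁) ^ 2 + (t - t₁) ^ 2 + (s' - σ₂) ^ 2 := by positivity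
    simp only [hP] at hge
    linarith)
  dsimp only at hFlt
  have hpen : γ * (t - t') ^ 2 + (s - σ₁) ^ 2 + (t - t₁) ^ 2 + (s' - σ₂) ^ 2 < e' ^ 2 := by
    simp only [hP] at hge
    linarith
  have hb := (hBmem _).1 hzB
  dsimp only at hb
  have ha2 : (t - t') ^ 2 ≤ γ * (t - t') ^ 2 := le_mul_of_one_le_left (sq_nonneg _) hγ1
  have n1 := sq_nonneg (s' - σ₂)
  have n2 := sq_nonneg (t - t')
  have n3 := sq_nonneg (s - σ₁)
  have n4 := sq_nonneg (t - t₁)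
  have b1 : |s' - σ₂| < e' := abs_lt_of_sq_lt_sq (by linarith) he'.le
  have b2 : |t - t'| < e' := abs_lt_of_sq_lt_sq (by linarith) he'.le
  have b3 : |s - σ₁| < e' := abs_lt_of_sq_lt_sq (by linarith) he'.le
  have b4 : |t - t₁| < e' := abs_lt_of_sq_lt_sq (by linarith) he'.le
  have b5 : |σ₁ - σ₂| < e := abs_lt_of_sq_lt_sq
    ((le_mul_of_one_le_left (sq_nonneg _) hα1).trans_lt hσ) he.le
  have b6 : |s - s'| ≤ |σ₁ - σ₂| + 2 * e' := by
    have h1 : s - s' = (σ₁ - σ₂) + ((s - σ₁) - (s' - σ₂)) := by ring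
    have h2 := abs_add_le (σ₁ - σ₂) ((s - σ₁) - (s' - σ₂))
    have h3 := abs_sub (s - σ₁) (s' - σ₂)
    rw [← h1] at h2
    linarith
  have b7 : |t' - t₁| < 2 * e' := by
    rw [abs_lt] at b2 b4 ⊢; constructor <;> linarith
  obtain ⟨htpos, htr⟩ := ht_box t hb.1.2
  obtain ⟨htpos', htr'⟩ := ht_box t' hb.2.2
  have hnhds : B ∈ 𝓝 (((s, t), (s', t')) : (ℝ × ℝ) × (ℝ × ℝ)) := by
    refine closedBall_mem_nhds_of_mem ?_
    simp only [mem_ball, Prod.dist_eq, Real.dist_eq, max_lt_iff]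
    refine ⟨⟨?_, ?_⟩, ?_, ?_⟩ <;> linarith
  obtain ⟨a, ha, hineq⟩ := h.doubled_inequality (i := i) (s := s) (t := t) (s' := s') (t' := t')
    (α := α) (γ := γ) (β := 1) (s₀ := s₀) (s₁ := σ₁) (t₁ := t₁) (s₂ := σ₂) (κ := 1) htpos htpos'
    (by filter_upwards [hnhds] with z hz using hzmax hz)
  have hQ : γ * |t - t'| ≤ K + 2 := by
    have hz' : (((s, t'), (s', t')) : (ℝ × ℝ) × (ℝ × ℝ)) ∈ B := (hBmem _).2 ⟨⟨hb.1.1, hb.2.2⟩, hb.2⟩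
    have h1 := hzmax hz'
    simp only [mem_ofPred_eq, hP] at h1
    have h2 := (abs_le.1 (hLip s t t' htpos.le htr htpos'.le htr')).2
    have h3 : (t' - t) * (2 * t + 2 * t' - 2 * t₁) ≤ |t - t'| * 2 := by
      rw [abs_sub_comm]
      refine (le_abs_self _).trans ?_
      rw [abs_mul]
      gcongr
      rw [abs_lt] at b4 b7
      rw [abs_le]; constructor <;> linarith
    have h4 : γ * |t - t'| * |t - t'| ≤ (K + 2) * |t - t'| := by
      have : γ * |t - t'| * |t - t'| = γ * (t - t') ^ 2 := by rw [mul_assoc, abs_mul_abs_self]; ring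
      rw [this]
      linarith
    rcases (abs_nonneg (t - t')).eq_or_lt with h0 | h0
    · rw [← h0]; linarith
    · exact le_of_mul_le_mul_right h4 h0
  have hll := hl s t s' t' (hs_box _ hb.1.1) (hs'_box _ hb.2.1) htpos.le htr htpos'.le htr'
    (by linarith) (by linarith) a ha
  have hbl := h.b_lip i s t s' t' htpos.le htpos'.le a ha
  have hcl := h.c_lip i s t s' t' htpos.le htpos'.le a ha
  have hbb := h.b_bdd i s t htpos.le a ha
  have hbb' := h.b_bdd i s' t' htpos'.le a ha
  have hcb := h.c_bdd i s t htpos.le a ha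
  have hee1 : e ^ 2 ≤ e := by rw [sq]; exact mul_le_of_le_one_left he.le (by linarith)
  have T1 : 2 * α * (s - s') * (b i s t a - b i s' t' a) ≤ 26 * L * e := by
    have h1 : 2 * α * (s - s') * (b i s t a - b i s' t' a) ≤
        2 * α * |s - s'| * (L * (|s - s'| + |t - t'|)) := by
      refine (le_abs_self _).trans ?_
      rw [abs_mul, abs_mul, abs_of_nonneg (by positivity : 0 ≤ 2 * α)]
      gcongr
    have h2 : α * |s - s'| * (|s - s'| + |t - t'|) ≤ 13 * e := by
      have g1 : α * |s - s'| * (|s - s'| + |t - t'|) ≤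
          α * (|σ₁ - σ₂| + 2 * e') * (|σ₁ - σ₂| + 2 * e' + e') := by gcongr
      have g2 : α * (|σ₁ - σ₂| + 2 * e') * (|σ₁ - σ₂| + 2 * e' + e') =
          α * (σ₁ - σ₂) ^ 2 + 5 * (α * e') * |σ₁ - σ₂| + 6 * (α * e') * e' := by
        rw [← sq_abs (σ₁ - σ₂)]; ring
      have g3 : 5 * (α * e') * |σ₁ - σ₂| ≤ 5 * e * e := by gcongr
      have g4 : 6 * (α * e') * e' ≤ 6 * e * e := by gcongr
      linarith
    have h3 := mul_le_mul_of_nonneg_left h2 hL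
    linarith
  have T2 : 2 * γ * (t - t') * (c i s t a - c i s' t' a) ≤ 8 * (K + 2) * L * e := by
    have h1 : 2 * γ * (t - t') * (c i s t a - c i s' t' a) ≤
        2 * (γ * |t - t'|) * (L * (|s - s'| + |t - t'|)) := by
      refine (le_abs_self _).trans ?_
      rw [abs_mul, abs_mul, abs_of_nonneg (by positivity : 0 ≤ 2 * γ), mul_assoc 2 γ]
      gcongr
    have h2 : 2 * (γ * |t - t'|) * (L * (|s - s'| + |t - t'|)) ≤ 2 * (K + 2) * (L * (3 * e + e)) := by
      gcongr <;> linarith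
    linarith
  have T3 : (2 * 1 * (s - s₀) + 2 * (s - σ₁)) * b i s t a ≤ 6 * e * Mf := by
    refine (le_abs_self _).trans ?_
    rw [abs_mul]
    gcongr
    rw [abs_lt] at b3
    rw [abs_le]; constructor <;> linarith
  have T4 : (2 * 1 * t + 2 * (t - t₁)) * c i s t a ≤ 6 * e * Mf := by
    refine (le_abs_self _).trans ?_
    rw [abs_mul]
    gcongr
    rw [abs_lt] at b4
    rw [abs_le]; constructor <;> linarith
  have T5 : 2 * 1 * (s' - σ₂) * b i s' t' a ≤ 2 * e * Mf := by
    refine (le_abs_self _).trans ?_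
    rw [abs_mul]
    gcongr
    rw [abs_lt] at b1
    rw [abs_le]; constructor <;> linarith
  have T6 := (le_abs_self _).trans hll
  linarith

end CoordProblem

lemma exists_approx_lower_slope {g : ℝ → ℝ} {G K r : ℝ} (hr : 0 < r)
    (hg : ∀ t, 0 ≤ t → t ≤ r → |g t - G| ≤ K * t) {ε : ℝ} (hε : 0 < ε) :
    ∃ ρ, |ρ| ≤ K + ε ∧ (∃ τ > 0, ∀ t, 0 ≤ t → t ≤ τ → G + ρ * t ≤ g t) ∧
      ∀ τ > 0, ∃ t, 0 < t ∧ t < τ ∧ g t ≤ G + (ρ + ε) * t := by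
  set S : Set ℝ := {ρ | ∃ τ > 0, ∀ t, 0 ≤ t → t ≤ τ → G + ρ * t ≤ g t} with hS
  have hmem : -K ∈ S := ⟨r, hr, fun t h0 h1 => by have := abs_le.1 (hg t h0 h1); linarith⟩
  have hub : ∀ ρ ∈ S, ρ ≤ K := by
    rintro ρ ⟨τ, hτ, h⟩
    have hpos : 0 < min τ r := lt_min hτ hr
    have h1 := h _ hpos.le (min_le_left _ _)
    have h2 := abs_le.1 (hg _ hpos.le (min_le_right _ _))
    exact le_of_mul_le_mul_right (by linarith) hpos
  have hbdd : BddAbove S := ⟨K, hub⟩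
  obtain ⟨ρ, hρS, hρ⟩ := exists_lt_of_lt_csSup ⟨_, hmem⟩ (sub_lt_self (sSup S) hε)
  have h1 := le_csSup hbdd hmem
  refine ⟨ρ, abs_le.2 ⟨by linarith, by linarith [hub ρ hρS]⟩, hρS, fun τ hτ => ?_⟩
  have hnot : ρ + ε ∉ S := fun hcon => by have := le_csSup hbdd hcon; linarith
  simp only [hS, mem_ofPred_eq, not_exists, not_and, not_forall] at hnot
  obtain ⟨t, h0, ht, hlt⟩ := hnot (τ / 2) (by positivity)
  refine ⟨t, lt_of_le_of_ne h0 ?_, by linarith, by linarith⟩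
  rintro rfl
  have := abs_le.1 (hg 0 le_rfl hr.le)
  linarith

namespace CoordProblem

variable {N : ℕ} {A : Type} {Ai : Fin N → Set A} {b c l : Fin N → ℝ → ℝ → A → ℝ}
  {lam c₀ Mf L : ℝ} {U V : Fin N → ℝ → ℝ → ℝ}

/-- The estimate of the difference of the two solutions when the function in which only the
tangential variable is doubled has a maximum on the interface. -/
lemma le_of_isMax_on_iface (h : CoordProblem Ai b c l lam c₀ Mf L U V)
    {s₀ σ₁ σ₂ r α e K d η M : ℝ} (he : 0 < e) (her : 6 * e ≤ r) (hr1 : r ≤ 1) (hα1 : 1 ≤ α)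
    (hσ₁ : |σ₁ - s₀| < e) (hσ₂ : |σ₂ - s₀| < 2 * e)
    (hσ : α * (σ₁ - σ₂) ^ 2 < e ^ 2) (hK : 0 ≤ K)
    (hLip : ∀ i s t t', 0 ≤ t → t ≤ r → 0 ≤ t' → t' ≤ r → |U i s t - U i s t'| ≤ K * |t - t'|)
    (hd : 3 * e ≤ d)
    (hl : ∀ i s t s' t', |s - s₀| ≤ r → |s' - s₀| ≤ r → 0 ≤ t → t ≤ r →
      0 ≤ t' → t' ≤ r → |s - s'| < d → |t - t'| < d → ∀ a ∈ Ai i, |l i s t a - l i s' t' a| ≤ η)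
    (hmax : ∀ i s t s', |s - s₀| ≤ r → |s' - s₀| ≤ r → 0 ≤ t → t ≤ r →
      U i s t - V i s' t - (α * (s - s') ^ 2 + (s - s₀) ^ 2 + t ^ 2) ≤
      U i σ₁ 0 - V i σ₂ 0 - (α * (σ₁ - σ₂) ^ 2 + (σ₁ - s₀) ^ 2))
    (hM : ∀ i, M ≤ U i σ₁ 0 - V i σ₂ 0 - (α * (σ₁ - σ₂) ^ 2 + (σ₁ - s₀) ^ 2)) :
    lam * M ≤ c₀ + η + (18 * Mf + 6 * L + 3 * (K + 2) * L + lam * (K + 2)) * e := by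
  have hL := h.L_nonneg
  have hMf := h.Mf_nonneg
  have hlam := h.lam_pos
  have hα0 : 0 ≤ α := by linarith
  have hr : 0 < r := by linarith
  have b5 : |σ₁ - σ₂| < e := abs_lt_of_sq_lt_sq
    ((le_mul_of_one_le_left (sq_nonneg _) hα1).trans_lt hσ) he.le
  have hσ₁r : |σ₁ - s₀| ≤ r := by linarith
  have hσ₂r : |σ₂ - s₀| < r := by linarith
  set H : Fin N → ℝ → ℝ → ℝ := fun j s t =>
    U j s t - (α * (s - σ₂) ^ 2 + (s - s₀) ^ 2 + t ^ 2 + (s - σ₁) ^ 2) with hH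
  have hHc : ∀ j, Continuous fun z : ℝ × ℝ => H j z.1 z.2 := fun j =>
    (h.U_cont j).sub (by fun_prop)
  have hH0 : ∀ j s, |s - s₀| ≤ r → H j s 0 ≤ H j σ₁ 0 - (s - σ₁) ^ 2 := fun j s hs => by
    have := hmax j s 0 σ₂ hs hσ₂r.le le_rfl hr.le
    simp only [hH]
    linarith
  have hHt : ∀ j s t, 0 ≤ t → t ≤ r → |s - s₀| ≤ r → H j s t ≤ H j σ₁ 0 + K * t - (s - σ₁) ^ 2 := by
    intro j s t h0 h1 hs
    have e1 := hH0 j s hs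
    have e2 := (abs_le.1 (hLip j s t 0 h0 h1 le_rfl hr.le)).2
    rw [sub_zero, abs_of_nonneg h0] at e2
    have : 0 ≤ t ^ 2 := sq_nonneg t
    simp only [hH] at e1 ⊢
    linarith
  have hHσ : ∀ j t, 0 ≤ t → t ≤ r → H j σ₁ 0 - K * t - t ^ 2 ≤ H j σ₁ t := by
    intro j t h0 h1
    have e2 := (abs_le.1 (hLip j σ₁ t 0 h0 h1 le_rfl hr.le)).1
    rw [sub_zero, abs_of_nonneg h0] at e2
    simp only [hH]
    linarith
  have hsq : ∀ t, 0 ≤ t → t ≤ r → t ^ 2 ≤ t := fun t h0 h1 => by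
    rw [sq]; exact mul_le_of_le_one_left h0 (by linarith)
  have hex : ∀ j t, ∃ s, |s - s₀| ≤ r ∧ ∀ s', |s' - s₀| ≤ r → H j s' t ≤ H j s t := by
    intro j t
    have hc : Continuous fun s => H j s t := (hHc j).comp (Continuous.prodMk_left t)
    obtain ⟨s, hs, hm⟩ := (isCompact_closedBall s₀ r).exists_isMaxOn
      ⟨s₀, mem_closedBall_self hr.le⟩ hc.continuousOn
    exact ⟨s, by simpa [Real.dist_eq] using hs, fun s' hs' =>
      hm (by simpa [Real.dist_eq] using hs')⟩
  choose S hSr hSmax using hex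
  have hslope : ∀ j t, 0 ≤ t → t ≤ r → |H j (S j t) t - H j σ₁ 0| ≤ (K + 1) * t := by
    intro j t h0 h1
    have e1 := hHt j _ t h0 h1 (hSr j t)
    have e2 := hHσ j t h0 h1
    have e3 := hSmax j t σ₁ hσ₁r
    have e4 := hsq t h0 h1
    have e5 := sq_nonneg (S j t - σ₁)
    rw [abs_le]; constructor <;> linarith
  choose ρ hρ hρlow hρup using fun j =>
    exists_approx_lower_slope (g := fun t => H j (S j t) t) hr (hslope j) he
  have hρK : ∀ j, |ρ j| ≤ K + 2 := fun j => (hρ j).trans (by linarith)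
  have htouch : ∀ j, TouchBelow (V j) σ₂ 0 (2 * α * (σ₁ - σ₂)) (ρ j) (α + α ^ 2) := by
    intro j
    obtain ⟨τ, hτ, hlow⟩ := hρlow j
    have hn1 : ∀ᶠ z : ℝ × ℝ in 𝓝 (σ₂, 0), |z.1 - s₀| < r :=
      (by fun_prop : Continuous fun z : ℝ × ℝ => |z.1 - s₀|).continuousAt.eventually_lt_const hσ₂r
    have hn2 : ∀ᶠ z : ℝ × ℝ in 𝓝 (σ₂, 0), z.2 < min τ r :=
      continuous_snd.continuousAt.eventually_lt_const (lt_min hτ hr)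
    filter_upwards [hn1, hn2] with z h1 h2 h0
    rw [lt_min_iff] at h2
    have e1 := hlow z.2 h0 h2.1.le
    have e2 := hmax j (S j z.2) z.2 z.1 (hSr j _) h1.le h0 h2.2.le
    have e3 := sq_nonneg (S j z.2 - σ₁ + α * (z.1 - σ₂))
    have e4 : 0 ≤ (α + α ^ 2) * z.2 ^ 2 := by positivity
    simp only [hH] at e1
    linarith
  obtain ⟨j, a, ha, hsup⟩ := h.super_iface σ₂ _ ρ _ htouch
  obtain ⟨e', he', hee, hαe'⟩ := exists_small_mul_le (C := α) (η := e) (r := e) hα0 he he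
  obtain ⟨τ, hτ, hlow⟩ := hρlow j
  obtain ⟨t', ht', ht'lt, hup⟩ := hρup j (min (min τ r) (min e' (e' ^ 2 / (2 * K + 1))))
    (by positivity)
  simp only [lt_min_iff] at ht'lt
  obtain ⟨⟨ht'τ, ht'r⟩, ht'e, ht'e2⟩ := ht'lt
  rw [lt_div_iff₀ (by positivity)] at ht'e2
  set B := 8 * e / t' with hB
  have hBt : B * t' = 8 * e := div_mul_cancel₀ _ ht'.ne'
  have hB0 : 0 ≤ B := by positivity
  have hQc : Continuous fun z : ℝ × ℝ => H j z.1 z.2 - (ρ j * z.2 + B * (z.2 - t' / 2) ^ 2) :=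
    (hHc j).sub (by fun_prop)
  have hmid : ((S j (t' / 2), t' / 2) : ℝ × ℝ) ∈ closedBall s₀ r ×ˢ Icc 0 t' :=
    ⟨by simpa [Real.dist_eq] using hSr j (t' / 2), by constructor <;> dsimp only <;> linarith⟩
  obtain ⟨⟨s, t⟩, hmem, hstmax⟩ := ((isCompact_closedBall s₀ r).prod isCompact_Icc).exists_isMaxOn
    ⟨_, hmid⟩ hQc.continuousOn
  have hstmax' : ∀ s' t'', |s' - s₀| ≤ r → 0 ≤ t'' → t'' ≤ t' →
      H j s' t'' - (ρ j * t'' + B * (t'' - t' / 2) ^ 2) ≤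
      H j s t - (ρ j * t + B * (t - t' / 2) ^ 2) := fun s' t'' h1 h2 h3 =>
    hstmax (show (s', t'') ∈ closedBall s₀ r ×ˢ Icc 0 t' from
      ⟨by simpa [Real.dist_eq] using h1, h2, h3⟩)
  obtain ⟨hsr, ht0, htt'⟩ : |s - s₀| ≤ r ∧ 0 ≤ t ∧ t ≤ t' :=
    ⟨by simpa [Real.dist_eq] using hmem.1, hmem.2.1, hmem.2.2⟩
  have htr : t ≤ r := by linarith
  have hval : H j σ₁ 0 ≤ H j s t - (ρ j * t + B * (t - t' / 2) ^ 2) := by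
    have e1 := hstmax' (S j (t' / 2)) (t' / 2) (hSr j _) (by linarith) (by linarith)
    have e2 := hlow (t' / 2) (by linarith) (by linarith)
    rw [sub_self] at e1
    linarith
  have hend : B * (t' / 2) ^ 2 = 2 * e * t' := by
    calc B * (t' / 2) ^ 2 = (B * t') * t' / 4 := by ring
      _ = 2 * e * t' := by rw [hBt]; ring
  have het' : 0 < e * t' := by positivity
  have htpos : 0 < t := by
    refine lt_of_le_of_ne ht0 ?_
    rintro rfl
    have e1 := hH0 j s hsr
    have e2 := sq_nonneg (s - σ₁)
    have e3 : B * (0 - t' / 2) ^ 2 = 2 * e * t' := by rw [← hend]; ring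
    linarith
  have htlt : t < t' := by
    refine lt_of_le_of_ne htt' ?_
    rintro rfl
    have e1 := hSmax j t s hsr
    have e3 : B * (t - t / 2) ^ 2 = 2 * e * t := by rw [← hend]; ring
    linarith
  have hss : |s - σ₁| ≤ e' := by
    refine abs_le_of_sq_le_sq ?_ he'.le
    have e1 := hstmax' σ₁ t hσ₁r ht0 htt'
    have e2 := hHσ j t ht0 htr
    have e3 := hLip j s t 0 ht0 htr le_rfl hr.le
    rw [sub_zero, abs_of_nonneg ht0, abs_le] at e3
    have e4 := hH0 j s hsr
    have e5 : K * t ≤ K * t' := mul_le_mul_of_nonneg_left htt' hK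
    simp only [hH] at e1 e2 e4
    linarith
  have hss' := abs_le.1 hss
  have hσ₁' := abs_lt.1 hσ₁
  have hσ₂' := abs_lt.1 hσ₂
  have hssr : |s - s₀| < r := by
    rw [abs_lt]; constructor <;> linarith
  have habove : TouchAbove (U j) s t (2 * α * (s - σ₂) + 2 * (s - s₀) + 2 * (s - σ₁))
      (ρ j + 2 * t + 2 * B * (t - t' / 2)) (α + B + 2) := by
    have hn1 : ∀ᶠ z : ℝ × ℝ in 𝓝 (s, t), |z.1 - s₀| < r :=
      (by fun_prop : Continuous fun z : ℝ × ℝ => |z.1 - s₀|).continuousAt.eventually_lt_const hssr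
    have hn2 : ∀ᶠ z : ℝ × ℝ in 𝓝 (s, t), z.2 < t' :=
      continuous_snd.continuousAt.eventually_lt_const htlt
    filter_upwards [hn1, hn2] with z h1 h2 h0
    have e1 := hstmax' z.1 z.2 h1.le h0 h2.le
    have e2 : 0 ≤ B * (z.1 - s) ^ 2 := by positivity
    have e3 : 0 ≤ α * (z.2 - t) ^ 2 := by positivity
    have e4 := sq_nonneg (z.2 - t)
    simp only [hH] at e1
    linarith
  have hsub := h.sub_int j s t htpos _ _ _ habove a ha
  have hsσ₂ : |s - σ₂| ≤ |σ₁ - σ₂| + e' := by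
    have := abs_sub_le s σ₁ σ₂
    linarith
  have hll := hl j s t σ₂ 0 hsr hσ₂r.le ht0 htr le_rfl hr.le (by linarith)
    (by rw [sub_zero, abs_of_nonneg ht0]; linarith) a ha
  have hbl := h.b_lip j s t σ₂ 0 ht0 le_rfl a ha
  have hcl := h.c_lip j s t σ₂ 0 ht0 le_rfl a ha
  rw [sub_zero, abs_of_nonneg ht0] at hbl hcl
  have hbb := h.b_bdd j s t ht0 a ha
  have hcb := h.c_bdd j s t ht0 a ha
  have hee1 : e ^ 2 ≤ e := by rw [sq]; exact mul_le_of_le_one_left he.le (by linarith)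
  have T1 : (2 * α * (s - σ₁) + 2 * (s - s₀) + 2 * (s - σ₁)) * b j s t a ≤ 8 * e * Mf := by
    refine (le_abs_self _).trans ?_
    rw [abs_mul]
    gcongr
    have e1 : |α * (s - σ₁)| ≤ e := by
      rw [abs_mul, abs_of_nonneg hα0]
      exact (mul_le_mul_of_nonneg_left hss hα0).trans hαe'
    rw [abs_le] at e1 ⊢; constructor <;> linarith
  have T2 : 2 * α * (σ₁ - σ₂) * (b j s t a - b j σ₂ 0 a) ≤ 6 * L * e := by
    have h1 : 2 * α * (σ₁ - σ₂) * (b j s t a - b j σ₂ 0 a) ≤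
        2 * α * |σ₁ - σ₂| * (L * (|s - σ₂| + t)) := by
      refine (le_abs_self _).trans ?_
      rw [abs_mul, abs_mul, abs_of_nonneg (by positivity : 0 ≤ 2 * α)]
      gcongr
    have h2 : α * |σ₁ - σ₂| * (|s - σ₂| + t) ≤ 3 * e := by
      have g1 : α * |σ₁ - σ₂| * (|s - σ₂| + t) ≤ α * |σ₁ - σ₂| * (|σ₁ - σ₂| + e' + e') := by
        gcongr
        linarith
      have g2 : α * |σ₁ - σ₂| * (|σ₁ - σ₂| + e' + e') =
          α * (σ₁ - σ₂) ^ 2 + 2 * (α * e') * |σ₁ - σ₂| := by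
        rw [← sq_abs (σ₁ - σ₂)]; ring
      have g3 : 2 * (α * e') * |σ₁ - σ₂| ≤ 2 * e * e := by gcongr
      linarith
    have h3 := mul_le_mul_of_nonneg_left h2 hL
    linarith
  have T3 : (2 * t + 2 * B * (t - t' / 2)) * c j s t a ≤ 10 * e * Mf := by
    refine (le_abs_self _).trans ?_
    rw [abs_mul]
    gcongr
    have e1 : |B * (t - t' / 2)| ≤ 4 * e := by
      rw [abs_mul, abs_of_nonneg hB0]
      have : |t - t' / 2| ≤ t' / 2 := by rw [abs_le]; constructor <;> linarith
      have := mul_le_mul_of_nonneg_left this hB0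
      linarith
    rw [abs_le] at e1 ⊢; constructor <;> linarith
  have T4 : ρ j * (c j s t a - c j σ₂ 0 a) ≤ 3 * (K + 2) * L * e := by
    have h1 : ρ j * (c j s t a - c j σ₂ 0 a) ≤ (K + 2) * (L * (2 * e + e)) := by
      refine (le_abs_self _).trans ?_
      rw [abs_mul]
      have := hρK j
      refine mul_le_mul this (hcl.trans ?_) (abs_nonneg _) (by linarith)
      gcongr <;> linarith
    linarith
  have T5 := (le_abs_self _).trans hll
  have hdiff : M - (K + 2) * e ≤ U j s t - V j σ₂ 0 := by
    have e1 := hM j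
    have e2 := (abs_le.1 (hρK j)).1
    have e3 : -(K + 2) * t ≤ ρ j * t := mul_le_mul_of_nonneg_right (by linarith) ht0
    have e4 : (K + 2) * t ≤ (K + 2) * e := by gcongr; linarith
    have e5 : 0 ≤ B * (t - t' / 2) ^ 2 := by positivity
    have e6 : 0 ≤ α * (s - σ₂) ^ 2 + (s - s₀) ^ 2 + t ^ 2 + (s - σ₁) ^ 2 := by positivity
    simp only [hH] at hval
    linarith
  have hfin := mul_le_mul_of_nonneg_left hdiff hlam.le
  linarith

/-- The difference of the two solutions at a global maximum point on the interface. -/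
lemma le_of_isMax_iface (h : CoordProblem Ai b c l lam c₀ Mf L U V) {K τ : ℝ} (hK : 0 ≤ K)
    (hτ : 0 < τ) (hLip : ∀ i s t t', 0 ≤ t → t ≤ τ → 0 ≤ t' → t' ≤ τ →
      |U i s t - U i s t'| ≤ K * |t - t'|) {i₀ : Fin N} {s₀ : ℝ}
    (hmax : ∀ j s t, 0 ≤ t → U j s t - V j s t ≤ U i₀ s₀ 0 - V i₀ s₀ 0) :
    lam * (U i₀ s₀ 0 - V i₀ s₀ 0) ≤ c₀ := by
  have : Nonempty (Fin N) := ⟨i₀⟩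
  refine le_of_forall_pos_le_add fun η hη => ?_
  obtain ⟨d, hd, hl⟩ := h.l_unif (|s₀| + 1) (η / 2) (by positivity)
  have hL := h.L_nonneg
  have hMf := h.Mf_nonneg
  have hlam := h.lam_pos
  set r := min 1 τ with hr
  have hr0 : 0 < r := by positivity
  have hr1 : r ≤ 1 := min_le_left _ _
  have hrτ : r ≤ τ := min_le_right _ _
  obtain ⟨e, he, her, heη⟩ := exists_small_mul_le
    (C := (26 * L + 8 * (K + 2) * L + 14 * Mf) +
      (18 * Mf + 6 * L + 3 * (K + 2) * L + lam * (K + 2))) (η := η / 2)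
    (r := min (r / 6) (d / 3)) (by positivity) (by positivity) (by positivity)
  obtain ⟨her, hed⟩ : e ≤ r / 6 ∧ e ≤ d / 3 := by simpa only [le_min_iff] using her
  set M := U i₀ s₀ 0 - V i₀ s₀ 0 with hM
  have hLip' : ∀ i s t t', 0 ≤ t → t ≤ r → 0 ≤ t' → t' ≤ r →
      |U i s t - U i s t'| ≤ K * |t - t'| := fun i s t t' h0 h1 h2 h3 =>
    hLip i s t t' h0 (h1.trans hrτ) h2 (h3.trans hrτ)
  have hl' : ∀ i s t s' t', |s - s₀| ≤ r → |s' - s₀| ≤ r → 0 ≤ t → t ≤ r →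
      0 ≤ t' → t' ≤ r → |s - s'| < d → |t - t'| < d →
      ∀ a ∈ Ai i, |l i s t a - l i s' t' a| ≤ η / 2 := by
    intro i s t s' t' h1 h2 h3 h4 h5 h6
    have hs : ∀ x, |x - s₀| ≤ r → |x| ≤ |s₀| + 1 := fun x hx => by
      have := abs_sub_abs_le_abs_sub x s₀
      linarith
    have := abs_nonneg s₀
    exact hl i s t s' t' (hs _ h1) (hs _ h2) h3 (by linarith) h5 (by linarith)
  set B : Set ((ℝ × ℝ) × ℝ) := (closedBall s₀ r ×ˢ Icc 0 r) ×ˢ closedBall s₀ r with hB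
  have hBc : IsCompact B :=
    ((isCompact_closedBall _ _).prod isCompact_Icc).prod (isCompact_closedBall _ _)
  have hBmem : ∀ z, z ∈ B ↔ (|z.1.1 - s₀| ≤ r ∧ 0 ≤ z.1.2 ∧ z.1.2 ≤ r) ∧ |z.2 - s₀| ≤ r := by
    intro z
    simp [hB, Real.dist_eq]
  have hcen : (((s₀, 0), s₀) : (ℝ × ℝ) × ℝ) ∈ B := by simp [hBmem, hr0.le]
  have hpen : ∀ j, ∃ α₀ : ℝ, ∀ α ≥ α₀, ∀ z ∈ B,
      M ≤ U j z.1.1 z.1.2 - V j z.2 z.1.2 - 0 - α * (z.1.1 - z.2) ^ 2 →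
      U j z.1.1 z.1.2 - V j z.2 z.1.2 - 0 < M + e ^ 2 := fun j => by
    refine exists_penalization_bound hBc (h.usc_diff j (X := (ℝ × ℝ) × ℝ) (x := fun z => z.1)
      (y := fun z => (z.2, z.1.2)) (P := fun _ => 0) (by fun_prop) (by fun_prop) (by fun_prop))
      (by fun_prop) (fun _ _ => by positivity) (fun z hz h0 => ?_) (by positivity)
    have h1 : z.1.1 = z.2 := by
      have : z.1.1 - z.2 = 0 := by simpa using h0
      linarith
    simpa [h1] using hmax j z.2 z.1.2 ((hBmem z).1 hz).1.2.1
  choose α₀ hα₀ using hpen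
  obtain ⟨α₁, hα₁⟩ := (Set.finite_range α₀).bddAbove
  set α := max α₁ 1 with hα
  have hα1 : 1 ≤ α := le_max_right _ _
  have hα0 : 0 ≤ α := by linarith
  have hαj : ∀ j, α₀ j ≤ α := fun j => (hα₁ (mem_range_self j)).trans (le_max_left _ _)
  set Φ : Fin N → (ℝ × ℝ) × ℝ → ℝ := fun j z =>
    U j z.1.1 z.1.2 - V j z.2 z.1.2 - (α * (z.1.1 - z.2) ^ 2 + (z.1.1 - s₀) ^ 2 + z.1.2 ^ 2)
    with hΦ
  have hex : ∀ j, ∃ z ∈ B, ∀ w ∈ B, Φ j w ≤ Φ j z := fun j => by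
    have husc := h.usc_diff j (X := (ℝ × ℝ) × ℝ) (x := fun z => z.1)
      (y := fun z => (z.2, z.1.2))
      (P := fun z => α * (z.1.1 - z.2) ^ 2 + (z.1.1 - s₀) ^ 2 + z.1.2 ^ 2)
      (by fun_prop) (by fun_prop) (by fun_prop)
    obtain ⟨z, hz, hzm⟩ := (husc.upperSemicontinuousOn B).exists_isMaxOn ⟨_, hcen⟩ hBc
    exact ⟨z, hz, fun w hw => hzm hw⟩
  choose z hzB hzmax using hex
  obtain ⟨i, hi⟩ := Finite.exists_max fun j => Φ j (z j)
  have hmaxi : ∀ j w, w ∈ B → Φ j w ≤ Φ i (z i) := fun j w hw => (hzmax j w hw).trans (hi j)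
  obtain ⟨⟨⟨σ₁, t₁⟩, σ₂⟩, hzi⟩ : ∃ w, z i = w := ⟨_, rfl⟩
  have hzB' := (hBmem _).1 (hzB i)
  rw [hzi] at hmaxi hzB'
  obtain ⟨⟨hσ₁r, ht₁0, ht₁r⟩, hσ₂r⟩ := hzB'
  dsimp only at hσ₁r ht₁0 ht₁r hσ₂r
  have hge : M ≤ Φ i ((σ₁, t₁), σ₂) := by
    have h0 : Φ i₀ ((s₀, 0), s₀) = M := by simp [hΦ, hM]
    exact h0.symm.le.trans (hmaxi i₀ _ hcen)
  have hsmall : α * (σ₁ - σ₂) ^ 2 + (σ₁ - s₀) ^ 2 + t₁ ^ 2 < e ^ 2 := by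
    have h1 := hα₀ i α (hαj i) _ (hzB i) (by
      rw [hzi]
      simp only [hΦ] at hge ⊢
      linarith [sq_nonneg (σ₁ - s₀), sq_nonneg t₁])
    rw [hzi] at h1
    simp only [hΦ] at hge h1
    linarith
  have q1 := mul_nonneg hα0 (sq_nonneg (σ₁ - σ₂))
  have q2 := sq_nonneg (σ₁ - s₀)
  have q3 := sq_nonneg t₁
  have hσ₁ : |σ₁ - s₀| < e := abs_lt_of_sq_lt_sq (by linarith) he.le
  have ht₁e : t₁ < e := (abs_lt.1 (abs_lt_of_sq_lt_sq (by linarith) he.le)).2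
  have hσ : α * (σ₁ - σ₂) ^ 2 < e ^ 2 := by linarith
  have hσ₁₂ : |σ₁ - σ₂| < e :=
    abs_lt_of_sq_lt_sq ((le_mul_of_one_le_left (sq_nonneg _) hα1).trans_lt hσ) he.le
  have hσ₂ : |σ₂ - s₀| < 2 * e := by
    rw [abs_lt] at hσ₁ hσ₁₂ ⊢
    constructor <;> linarith
  rcases ht₁0.eq_or_lt with ht | ht
  · subst ht
    have hg : ∀ j, U j σ₁ 0 - V j σ₂ 0 = U i σ₁ 0 - V i σ₂ 0 := fun j => by
      rw [h.U_glue j i, h.V_glue j i]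
    have := h.le_of_isMax_on_iface (M := M) (η := η / 2) (d := d) he (by linarith) hr1 hα1 hσ₁ hσ₂ hσ
      hK hLip' (by linarith) hl'
      (fun j s t s' h1 h2 h3 h4 => by
        have := hmaxi j ((s, t), s') ((hBmem _).2 ⟨⟨h1, h3, h4⟩, h2⟩)
        simp only [hΦ] at this
        rw [hg]
        linarith)
      (fun j => by
        rw [hg]
        simp only [hΦ] at hge
        linarith)
    have h3 : 0 ≤ (26 * L + 8 * (K + 2) * L + 14 * Mf) * e := by positivity
    linarith
  · have := h.le_of_isMax_near_iface (i := i) (M := M) (η := η / 2) (d := d) he (by linarith) hr1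
      hα1 ht ht₁e hσ₁ hσ₂ hσ hK (hLip' i) (by linarith) (hl' i)
      (fun s t s' h1 h2 h3 h4 => hmaxi i ((s, t), s') ((hBmem _).2 ⟨⟨h1, h3, h4⟩, h2⟩)) hge
    have h3 : 0 ≤ (18 * Mf + 6 * L + 3 * (K + 2) * L + lam * (K + 2)) * e := by positivity
    linarith

/-- The difference of the two solutions at a global maximum point. -/
lemma le_of_isMax (h : CoordProblem Ai b c l lam c₀ Mf L U V) {K τ : ℝ} (hK : 0 ≤ K)
    (hτ : 0 < τ) (hLip : ∀ i s t t', 0 ≤ t → t ≤ τ → 0 ≤ t' → t' ≤ τ →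
      |U i s t - U i s t'| ≤ K * |t - t'|) {i₀ : Fin N} {s₀ t₀ : ℝ} (ht₀ : 0 ≤ t₀)
    (hmax : ∀ j s t, 0 ≤ t → U j s t - V j s t ≤ U i₀ s₀ t₀ - V i₀ s₀ t₀) :
    lam * (U i₀ s₀ t₀ - V i₀ s₀ t₀) ≤ c₀ := by
  rcases ht₀.eq_or_lt with rfl | ht
  · exact h.le_of_isMax_iface hK hτ hLip hmax
  · exact h.le_of_isMax_interior ht (hmax i₀)

end CoordProblem

lemma touchAbove_of_le_cone {W : ℝ → ℝ → ℝ} {K D s₁ y s₀ t₀ : ℝ} (hK : 0 ≤ K) (hD : 0 < D)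
    (hD2 : D ^ 2 = (s₀ - s₁) ^ 2 + (t₀ - y) ^ 2)
    (hW : ∀ s t, 0 ≤ t → W s t - K * √((s - s₁) ^ 2 + (t - y) ^ 2) ≤ W s₀ t₀ - K * D) :
    TouchAbove W s₀ t₀ (K * ((s₀ - s₁) / D)) (K * ((t₀ - y) / D)) (K * (1 / (2 * D))) := by
  refine Eventually.of_forall fun z hz => ?_
  have h1 : √((z.1 - s₁) ^ 2 + (z.2 - y) ^ 2) ≤
      (((z.1 - s₁) ^ 2 + (z.2 - y) ^ 2) + D ^ 2) / (2 * D) := by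
    rw [le_div_iff₀ (by positivity)]
    have h := Real.sq_sqrt (show 0 ≤ (z.1 - s₁) ^ 2 + (z.2 - y) ^ 2 by positivity)
    nlinarith [sq_nonneg (√((z.1 - s₁) ^ 2 + (z.2 - y) ^ 2) - D)]
  have h2 : (((z.1 - s₁) ^ 2 + (z.2 - y) ^ 2) + D ^ 2) / (2 * D) = D + (s₀ - s₁) / D * (z.1 - s₀) +
      (t₀ - y) / D * (z.2 - t₀) + 1 / (2 * D) * ((z.1 - s₀) ^ 2 + (z.2 - t₀) ^ 2) := by
    field_simp
    linear_combination -hD2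
  have h3 := mul_le_mul_of_nonneg_left (h1.trans_eq h2) hK
  linarith [hW z.1 z.2 hz]

section Lipschitz

variable {N : ℕ} {A : Type} {Ai : Fin N → Set A} {b c l : Fin N → ℝ → ℝ → A → ℝ}
  {lam Mu Ml δ₀ R : ℝ} {U : Fin N → ℝ → ℝ → ℝ}

/-- A subsolution near the interface, where the Hamiltonian is coercive, lies below cones of large
slope. The reflected vertex makes the cone admissible on the other branches. -/
lemma le_cone_of_subsolution (hlam : 0 < lam) (hR : 0 < R)
    (hcont : ∀ i, Continuous fun z : ℝ × ℝ => U i z.1 z.2)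
    (hglue : ∀ i j s, U i s 0 = U j s 0)
    (hMu : ∀ i s t, 0 ≤ t → |U i s t| ≤ Mu)
    (hMl : ∀ i s t, 0 ≤ t → ∀ a ∈ Ai i, |l i s t a| ≤ Ml)
    (hint : ∀ i s t, 0 < t → ∀ p q C, TouchAbove (U i) s t p q C → ∀ a ∈ Ai i,
      lam * U i s t - p * b i s t a - q * c i s t a - l i s t a ≤ 0)
    (hface : ∀ s p (q : Fin N → ℝ) C, (∀ j, TouchAbove (U j) s 0 p (q j) C) → ∀ j, ∀ a ∈ Ai j,
      0 ≤ c j s 0 a → lam * U j s 0 - p * b j s 0 a - q j * c j s 0 a - l j s 0 a ≤ 0)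
    (hcoer : ∀ i s t p q, 0 ≤ t → t ≤ 2 * R → ∃ a ∈ Ai i,
      p * b i s t a + q * c i s t a ≤ -δ₀ * √(p ^ 2 + q ^ 2) ∧ (t = 0 → q ≤ 0 → 0 ≤ c i s t a))
    {K : ℝ} (hK : 0 < K) (hK1 : lam * Mu + Ml < K * δ₀) (hK2 : 2 * Mu < K * R)
    (i : Fin N) (s₁ : ℝ) {t₁ : ℝ} (ht₁ : 0 ≤ t₁) (ht₁R : t₁ ≤ R) {s t : ℝ} (ht : 0 ≤ t) :
    U i s t ≤ U i s₁ t₁ + K * √((s - s₁) ^ 2 + (t - t₁) ^ 2) := by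
  have : Nonempty (Fin N) := ⟨i⟩
  set y : Fin N → ℝ := fun j => if j = i then t₁ else -t₁ with hy
  have hyi : y i = t₁ := by simp [hy]
  have hysq : ∀ j, y j ^ 2 = t₁ ^ 2 := fun j => by simp only [hy]; split_ifs <;> ring
  have hyle : ∀ j, y j ≤ t₁ := fun j => by simp only [hy]; split_ifs <;> linarith
  set D : Fin N → ℝ × ℝ → ℝ := fun j z => √((z.1 - s₁) ^ 2 + (z.2 - y j) ^ 2) with hD
  have hD2 : ∀ j z, D j z ^ 2 = (z.1 - s₁) ^ 2 + (z.2 - y j) ^ 2 := fun j z =>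
    Real.sq_sqrt (by positivity)
  have hD0 : ∀ j z, 0 ≤ D j z := fun j z => Real.sqrt_nonneg _
  have hDs : ∀ j z, |z.1 - s₁| ≤ D j z := fun j z =>
    Real.abs_le_sqrt (by linarith [sq_nonneg (z.2 - y j)])
  have hDt : ∀ j z, |z.2 - y j| ≤ D j z := fun j z =>
    Real.abs_le_sqrt (by linarith [sq_nonneg (z.1 - s₁)])
  by_contra! hcon
  set B : Set (ℝ × ℝ) := closedBall s₁ R ×ˢ Icc 0 (t₁ + R) with hB
  have hBc : IsCompact B := (isCompact_closedBall _ _).prod isCompact_Icc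
  have hBmem : ∀ z, z ∈ B ↔ |z.1 - s₁| ≤ R ∧ 0 ≤ z.2 ∧ z.2 ≤ t₁ + R := fun z => by
    simp [hB, Real.dist_eq]
  have hlow : ∀ j z, 0 ≤ z.2 → U i s₁ t₁ < U j z.1 z.2 - K * D j z → D j z < R := by
    intro j z hz hlt
    have h1 := abs_le.1 (hMu j z.1 z.2 hz)
    have h2 := abs_le.1 (hMu i s₁ t₁ ht₁)
    exact lt_of_mul_lt_mul_left (by linarith) hK.le
  have hin : ∀ j z, 0 ≤ z.2 → D j z < R → z ∈ B := by
    intro j z hz hlt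
    refine (hBmem z).2 ⟨(hDs j z).trans hlt.le, hz, ?_⟩
    have := (abs_le.1 ((hDt j z).trans hlt.le)).2
    linarith [hyle j]
  have hcen : (s₁, t₁) ∈ B := (hBmem _).2 ⟨by simpa using hR.le, ht₁, by linarith⟩
  have hex : ∀ j, ∃ z ∈ B, ∀ w ∈ B, U j w.1 w.2 - K * D j w ≤ U j z.1 z.2 - K * D j z := fun j => by
    have hc : Continuous fun z : ℝ × ℝ => U j z.1 z.2 - K * D j z :=
      (hcont j).sub (by fun_prop)
    obtain ⟨z, hz, hm⟩ := hBc.exists_isMaxOn ⟨_, hcen⟩ hc.continuousOn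
    exact ⟨z, hz, fun w hw => hm hw⟩
  choose z hzB hzm using hex
  obtain ⟨k, hk⟩ := Finite.exists_max fun j => U j (z j).1 (z j).2 - K * D j (z j)
  obtain ⟨⟨s₀, t₀⟩, hzk⟩ : ∃ w, z k = w := ⟨_, rfl⟩
  have hB0 := (hBmem _).1 (hzB k)
  rw [hzk] at hB0
  have ht₀ : 0 ≤ t₀ := hB0.2.1
  have hbig : U i s₁ t₁ < U k s₀ t₀ - K * D k (s₀, t₀) := by
    have hlt : U i s₁ t₁ < U i (s, t).1 (s, t).2 - K * D i (s, t) := by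
      simp only [hD, hyi]
      linarith
    have h1 := hzm i _ (hin i (s, t) ht (hlow i _ ht hlt))
    have h2 := hk i
    simp only [hzk] at h2
    linarith
  have hglob : ∀ j s t, 0 ≤ t → U j s t - K * D j (s, t) ≤ U k s₀ t₀ - K * D k (s₀, t₀) := by
    intro j s t ht
    by_cases hlt : U i s₁ t₁ < U j s t - K * D j (s, t)
    · have h1 := hzm j _ (hin j (s, t) ht (hlow j (s, t) ht hlt))
      have h2 := hk j
      simp only [hzk] at h2
      exact h1.trans h2
    · linarith
  have hDpos : 0 < D k (s₀, t₀) := by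
    refine lt_of_le_of_ne (hD0 _ _) fun h0 => ?_
    have e1 := hDs k (s₀, t₀)
    have e2 := hDt k (s₀, t₀)
    rw [← h0] at e1 e2
    have e1' : s₀ = s₁ := by simpa [sub_eq_zero] using e1
    have e2' : t₀ = y k := by simpa [sub_eq_zero] using e2
    rw [← h0, e1', e2', mul_zero, sub_zero] at hbig
    by_cases hki : k = i
    · rw [hki, hyi] at hbig
      exact lt_irrefl _ hbig
    · have hyk : y k = -t₁ := by simp [hy, hki]
      have ht0 : t₁ = 0 := by linarith
      rw [hyk, ht0, neg_zero, hglue i k] at hbig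
      exact lt_irrefl _ hbig
  set d := D k (s₀, t₀) with hd
  have hdR : d < R := hlow k (s₀, t₀) ht₀ hbig
  have ht₀R : t₀ ≤ 2 * R := by
    have := hB0.2.2
    dsimp only at this
    linarith
  have hfinish : ∀ j y', d ^ 2 = (s₀ - s₁) ^ 2 + (t₀ - y') ^ 2 →
      (∀ a ∈ Ai j, (t₀ = 0 → K * ((t₀ - y') / d) ≤ 0 → 0 ≤ c j s₀ t₀ a) →
        lam * U j s₀ t₀ - K * ((s₀ - s₁) / d) * b j s₀ t₀ a - K * ((t₀ - y') / d) * c j s₀ t₀ a -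
          l j s₀ t₀ a ≤ 0) → False := by
    intro j y' hdy hsub
    obtain ⟨a, ha, hco, hc0⟩ := hcoer j s₀ t₀ (K * ((s₀ - s₁) / d)) (K * ((t₀ - y') / d)) ht₀ ht₀R
    have hgrad : √((K * ((s₀ - s₁) / d)) ^ 2 + (K * ((t₀ - y') / d)) ^ 2) = K := by
      rw [Real.sqrt_eq_iff_eq_sq (by positivity) hK.le]
      field_simp
      exact hdy.symm
    rw [hgrad] at hco
    have h1 := hsub a ha hc0
    have h2 := abs_le.1 (hMl j s₀ t₀ ht₀ a ha)
    have h3 := mul_le_mul_of_nonneg_left (abs_le.1 (hMu j s₀ t₀ ht₀)).1 hlam.le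
    linarith
  rcases ht₀.eq_or_lt with h0 | h0
  · have hd' : ∀ j, d ^ 2 = (s₀ - s₁) ^ 2 + (t₀ - y j) ^ 2 := fun j => by
      rw [hd, hD2, ← h0]
      simp only [zero_sub, neg_sq, hysq]
    refine hfinish i (y i) (hd' i) fun a ha hc => ?_
    subst h0
    refine hface s₀ _ (fun j => K * ((0 - y j) / d)) (K * (1 / (2 * d))) (fun j => ?_) i a ha
      (hc rfl ?_)
    · refine touchAbove_of_le_cone hK.le hDpos (hd' j) fun s t ht => ?_
      rw [hglue j k s₀]
      exact hglob j s t ht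
    · rw [hyi, zero_sub, neg_div]
      have : 0 ≤ K * (t₁ / d) := by positivity
      linarith
  · exact hfinish k (y k) (hD2 k _) fun a ha _ => hint k s₀ t₀ h0 _ _ _
      (touchAbove_of_le_cone hK.le hDpos (hD2 k _) fun s t ht => hglob k s t ht) a ha

/-- A bounded subsolution is Lipschitz in the normal variable near the interface. -/
lemma exists_lipschitz_normal (hlam : 0 < lam) (hR : 0 < R) (hδ₀ : 0 < δ₀) (hMu0 : 0 ≤ Mu)
    (hMl0 : 0 ≤ Ml)
    (hcont : ∀ i, Continuous fun z : ℝ × ℝ => U i z.1 z.2)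
    (hglue : ∀ i j s, U i s 0 = U j s 0)
    (hMu : ∀ i s t, 0 ≤ t → |U i s t| ≤ Mu)
    (hMl : ∀ i s t, 0 ≤ t → ∀ a ∈ Ai i, |l i s t a| ≤ Ml)
    (hint : ∀ i s t, 0 < t → ∀ p q C, TouchAbove (U i) s t p q C → ∀ a ∈ Ai i,
      lam * U i s t - p * b i s t a - q * c i s t a - l i s t a ≤ 0)
    (hface : ∀ s p (q : Fin N → ℝ) C, (∀ j, TouchAbove (U j) s 0 p (q j) C) → ∀ j, ∀ a ∈ Ai j,
      0 ≤ c j s 0 a → lam * U j s 0 - p * b j s 0 a - q j * c j s 0 a - l j s 0 a ≤ 0)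
    (hcoer : ∀ i s t p q, 0 ≤ t → t ≤ 2 * R → ∃ a ∈ Ai i,
      p * b i s t a + q * c i s t a ≤ -δ₀ * √(p ^ 2 + q ^ 2) ∧ (t = 0 → q ≤ 0 → 0 ≤ c i s t a)) :
    ∃ K : ℝ, 0 ≤ K ∧ ∀ i s t t', 0 ≤ t → t ≤ R → 0 ≤ t' → t' ≤ R →
      |U i s t - U i s t'| ≤ K * |t - t'| := by
  set K := (lam * Mu + Ml) / δ₀ + 2 * Mu / R + 1 with hKdef
  have hK : 0 < K := by positivity
  have e1 : (lam * Mu + Ml) / δ₀ * δ₀ = lam * Mu + Ml := div_mul_cancel₀ _ hδ₀.ne'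
  have e2 : 2 * Mu / R * R = 2 * Mu := div_mul_cancel₀ _ hR.ne'
  have e3 : 0 ≤ (lam * Mu + Ml) / δ₀ * R := by positivity
  have e4 : 0 ≤ 2 * Mu / R * δ₀ := by positivity
  have hcone : ∀ i s t t', 0 ≤ t → 0 ≤ t' → t' ≤ R → U i s t ≤ U i s t' + K * |t - t'| := by
    intro i s t t' h0 h1 h2
    have := le_cone_of_subsolution hlam hR hcont hglue hMu hMl hint hface hcoer hK
      (by rw [hKdef]; linarith) (by rw [hKdef]; linarith) i s h1 h2 (s := s) h0
    simpa [Real.sqrt_sq_eq_abs] using this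
  refine ⟨K, hK.le, fun i s t t' h0 h1 h2 h3 => abs_le.2 ⟨?_, ?_⟩⟩
  · have := hcone i s t' t h2 h0 h1
    rw [abs_sub_comm] at this
    linarith
  · linarith [hcone i s t t' h0 h2 h3]

end Lipschitz

/-- The directions spanning the half-planes of a junction. -/
structure JunctionFrame {N : ℕ} (e0 : E3) (e : Fin N → E3) : Prop where
  norm_e0 : ‖e0‖ = 1
  norm_e : ∀ k, ‖e k‖ = 1
  inj : Function.Injective e
  orth : ∀ k, ⟪e k, e0⟫ = 0

/-- The point of the half-plane with coordinates `(s, |t|)`. -/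
def planePoint (e0 ei : E3) (s t : ℝ) : E3 := s • e0 + |t| • ei

lemma planePoint_mem_halfPlane (e0 ei : E3) (s t : ℝ) : planePoint e0 ei s t ∈ halfPlane e0 ei :=
  ⟨s, |t|, abs_nonneg t, rfl⟩

@[fun_prop]
lemma continuous_planePoint (e0 ei : E3) :
    Continuous fun z : ℝ × ℝ => planePoint e0 ei z.1 z.2 := by
  unfold planePoint
  fun_prop

@[simp]
lemma planePoint_zero (e0 ei : E3) (s : ℝ) : planePoint e0 ei s 0 = s • e0 := by
  simp [planePoint]

namespace JunctionFrame

variable {N : ℕ} {e0 : E3} {e : Fin N → E3}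

lemma planePoint_mem (e0 : E3) (e : Fin N → E3) (i : Fin N) (s t : ℝ) :
    planePoint e0 (e i) s t ∈ junction N e0 e :=
  mem_iUnion.2 ⟨i, planePoint_mem_halfPlane _ _ _ _⟩

lemma orth' (h : JunctionFrame e0 e) (k : Fin N) : ⟪e0, e k⟫ = 0 := by
  rw [real_inner_comm, h.orth]

lemma inner_e0_self (h : JunctionFrame e0 e) : ⟪e0, e0⟫ = 1 := by
  rw [real_inner_self_eq_norm_sq, h.norm_e0, one_pow]

lemma inner_e_self (h : JunctionFrame e0 e) (k : Fin N) : ⟪e k, e k⟫ = 1 := by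
  rw [real_inner_self_eq_norm_sq, h.norm_e, one_pow]

lemma inner_planePoint_e0 (h : JunctionFrame e0 e) (i : Fin N) (s t : ℝ) :
    ⟪planePoint e0 (e i) s t, e0⟫ = s := by
  simp only [planePoint, inner_add_left, real_inner_smul_left, h.inner_e0_self, h.orth]
  ring

lemma inner_planePoint_e (h : JunctionFrame e0 e) (i : Fin N) (s t : ℝ) :
    ⟪planePoint e0 (e i) s t, e i⟫ = |t| := by
  simp only [planePoint, inner_add_left, real_inner_smul_left, h.inner_e_self, h.orth']
  ring

lemma norm_smul_add_smul_sq (h : JunctionFrame e0 e) (i : Fin N) (p q : ℝ) :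
    ‖p • e0 + q • e i‖ ^ 2 = p ^ 2 + q ^ 2 := by
  rw [← real_inner_self_eq_norm_sq]
  simp only [inner_add_left, inner_add_right, real_inner_smul_left, real_inner_smul_right,
    h.inner_e_self, h.inner_e0_self, h.orth, h.orth']
  ring

lemma norm_planePoint_sq (h : JunctionFrame e0 e) (i : Fin N) (s t : ℝ) :
    ‖planePoint e0 (e i) s t‖ ^ 2 = s ^ 2 + t ^ 2 := by
  rw [planePoint, h.norm_smul_add_smul_sq, sq_abs]

lemma norm_planePoint_sub_le (h : JunctionFrame e0 e) (i : Fin N) (s t s' t' : ℝ) :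
    ‖planePoint e0 (e i) s t - planePoint e0 (e i) s' t'‖ ≤ |s - s'| + |t - t'| := by
  have h1 : planePoint e0 (e i) s t - planePoint e0 (e i) s' t' =
      (s - s') • e0 + (|t| - |t'|) • e i := by
    simp only [planePoint, sub_smul]
    abel
  rw [h1]
  refine (norm_add_le _ _).trans ?_
  rw [norm_smul, norm_smul, h.norm_e0, h.norm_e, mul_one, mul_one, Real.norm_eq_abs,
    Real.norm_eq_abs]
  exact add_le_add_right (abs_abs_sub_abs_le t t') _

lemma inner_nonneg (h : JunctionFrame e0 e) {i : Fin N} {x : E3} (hx : x ∈ halfPlane e0 (e i)) :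
    0 ≤ ⟪x, e i⟫ := by
  obtain ⟨s, t, ht, rfl⟩ := hx
  simpa only [inner_add_left, real_inner_smul_left, h.inner_e_self, h.orth', mul_zero, mul_one,
    zero_add] using ht

lemma planePoint_inner (h : JunctionFrame e0 e) {i : Fin N} {x : E3}
    (hx : x ∈ halfPlane e0 (e i)) : planePoint e0 (e i) ⟪x, e0⟫ ⟪x, e i⟫ = x := by
  rw [planePoint, abs_of_nonneg (h.inner_nonneg hx)]
  obtain ⟨s, t, ht, rfl⟩ := hx
  simp only [inner_add_left, real_inner_smul_left, h.inner_e_self, h.orth', h.inner_e0_self, h.orth,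
    mul_zero, mul_one, zero_add, add_zero]

lemma isClosed_halfPlane (h : JunctionFrame e0 e) (i : Fin N) :
    IsClosed (halfPlane e0 (e i)) := by
  have : halfPlane e0 (e i) = {x | planePoint e0 (e i) ⟪x, e0⟫ ⟪x, e i⟫ = x} :=
    Subset.antisymm (fun x hx => h.planePoint_inner hx) fun x hx => by
      rw [← show _ = x from hx]
      exact planePoint_mem_halfPlane _ _ _ _
  rw [this]
  refine isClosed_eq ?_ continuous_id
  unfold planePoint
  fun_prop

lemma inner_eq_zero (h : JunctionFrame e0 e) {i j : Fin N} (hij : i ≠ j) {x : E3}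
    (hi : x ∈ halfPlane e0 (e i)) (hj : x ∈ halfPlane e0 (e j)) : ⟪x, e i⟫ = 0 := by
  have h1 := h.planePoint_inner hi
  have h2 := h.planePoint_inner hj
  have h3 : |⟪x, e i⟫| • e i = |⟪x, e j⟫| • e j := by
    rw [planePoint] at h1 h2
    exact add_left_cancel (h1.trans h2.symm)
  have h4 : |⟪x, e i⟫| = |⟪x, e j⟫| := by
    have := congrArg norm h3
    simpa [norm_smul, h.norm_e] using this
  by_contra hne
  rw [← h4] at h3
  exact hij (h.inj (smul_right_injective E3 (abs_ne_zero.2 hne) h3))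

/-- The distance to the interface on the `j`-th half-plane, extended by `0`. -/
def normalCoord (e0 : E3) (e : Fin N → E3) (j : Fin N) : E3 → ℝ :=
  (halfPlane e0 (e j)).indicator fun x => ⟪x, e j⟫

/-- A quadratic function on the junction with a different normal slope on each branch. -/
def quadratic (e0 : E3) (e : Fin N → E3) (α : ℝ) (β : Fin N → ℝ) (C : ℝ) (x : E3) : ℝ :=
  α * ⟪x, e0⟫ + ∑ j, β j * normalCoord e0 e j x + C * ‖x‖ ^ 2

lemma quadratic_eqOn (h : JunctionFrame e0 e) (α : ℝ) (β : Fin N → ℝ) (C : ℝ) (i : Fin N) :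
    EqOn (quadratic e0 e α β C) (fun x => α * ⟪x, e0⟫ + β i * ⟪x, e i⟫ + C * ‖x‖ ^ 2)
      (halfPlane e0 (e i)) := by
  intro x hx
  have hsum : ∑ j, β j * normalCoord e0 e j x = β i * ⟪x, e i⟫ := by
    rw [Finset.sum_eq_single i]
    · rw [normalCoord, indicator_of_mem hx]
    · intro j _ hj
      by_cases hxj : x ∈ halfPlane e0 (e j)
      · rw [normalCoord, indicator_of_mem hxj, h.inner_eq_zero hj hxj hx, mul_zero]
      · rw [normalCoord, indicator_of_notMem hxj, mul_zero]
    · simp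
  simp only [quadratic, hsum]

/-- Quadratic functions as admissible test functions. -/
def quadTest (h : JunctionFrame e0 e) (α : ℝ) (β : Fin N → ℝ) (C : ℝ) : TestFun N e0 e where
  φ := quadratic e0 e α β C
  Dφ i x := α • e0 + β i • e i + (2 * C) • x
  cont := (locallyFinite_of_finite _).continuousOn_iUnion h.isClosed_halfPlane fun i =>
    ContinuousOn.congr (Continuous.continuousOn (by fun_prop)) (h.quadratic_eqOn α β C i)
  dphi_plane i x hx := by
    obtain ⟨s, t, -, rfl⟩ := hx
    exact ⟨α + 2 * C * s, β i + 2 * C * t, by simp only [smul_add, add_smul, smul_smul]; abel⟩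
  hasDeriv i x hx := by
    have h1 : HasFDerivAt (fun x => α * ⟪x, e0⟫ + β i * ⟪x, e i⟫ + C * ‖x‖ ^ 2)
        (innerSL ℝ (α • e0 + β i • e i + (2 * C) • x)) x := by
      have h2 := ((((innerSL ℝ e0).hasFDerivAt (x := x)).const_mul α).add
        (((innerSL ℝ (e i)).hasFDerivAt (x := x)).const_mul (β i))).add
        ((hasStrictFDerivAt_norm_sq x).hasFDerivAt.const_mul C)
      refine (h2.congr_fderiv ?_).congr_of_eventuallyEq (Eventually.of_forall fun y => ?_)
      · ext y
        simp
        ring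
      · simp [real_inner_comm]
    exact h1.hasFDerivWithinAt.congr (h.quadratic_eqOn α β C i) (h.quadratic_eqOn α β C i hx)
  contDeriv i := Continuous.continuousOn (by fun_prop)

lemma quadTest_planePoint (h : JunctionFrame e0 e) (α : ℝ) (β : Fin N → ℝ) (C : ℝ) (i : Fin N)
    (s t : ℝ) : (h.quadTest α β C).φ (planePoint e0 (e i) s t) =
      α * s + β i * |t| + C * (s ^ 2 + t ^ 2) := by
  have := h.quadratic_eqOn α β C i (planePoint_mem_halfPlane e0 (e i) s t)
  simp only [h.inner_planePoint_e0, h.inner_planePoint_e, h.norm_planePoint_sq] at this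
  exact this

lemma inner_quadTest (h : JunctionFrame e0 e) (β : Fin N → ℝ) (p C : ℝ) (i : Fin N) (s t : ℝ)
    (w : E3) : ⟪(h.quadTest (p - 2 * C * s) β C).Dφ i (planePoint e0 (e i) s t), w⟫ =
      p * ⟪w, e0⟫ + (β i + 2 * C * |t|) * ⟪w, e i⟫ := by
  rw [real_inner_comm]
  simp only [quadTest, planePoint, inner_add_right, real_inner_smul_right]
  ring

lemma eventually_halfPlane (h : JunctionFrame e0 e) (i : Fin N) {s t : ℝ} (ht : 0 ≤ t)
    {Q : ℝ × ℝ → Prop} (hQ : ∀ᶠ z in 𝓝 (s, t), Q z) :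
    ∀ᶠ x in 𝓝 (planePoint e0 (e i) s t), Q (⟪x, e0⟫, ⟪x, e i⟫) := by
  have hc : Continuous fun x : E3 => (⟪x, e0⟫, ⟪x, e i⟫) := by fun_prop
  have := hc.tendsto (planePoint e0 (e i) s t)
  rw [h.inner_planePoint_e0, h.inner_planePoint_e, abs_of_nonneg ht] at this
  exact this.eventually hQ

lemma not_mem_of_ne (h : JunctionFrame e0 e) {i j : Fin N} {s t : ℝ} (ht : 0 < t) (hij : i ≠ j) :
    planePoint e0 (e i) s t ∉ halfPlane e0 (e j) := fun hj => by
  have := h.inner_eq_zero hij (planePoint_mem_halfPlane e0 (e i) s t) hj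
  rw [h.inner_planePoint_e, abs_of_pos ht] at this
  exact ht.ne' this

lemma eventually_mem_halfPlane (h : JunctionFrame e0 e) {i : Fin N} {s t : ℝ} (ht : 0 < t) :
    ∀ᶠ x in 𝓝[junction N e0 e] (planePoint e0 (e i) s t), x ∈ halfPlane e0 (e i) := by
  have h1 : ∀ᶠ x in 𝓝 (planePoint e0 (e i) s t), ∀ j, i ≠ j → x ∉ halfPlane e0 (e j) :=
    eventually_all.2 fun j => eventually_imp_distrib_left.2 fun hij =>
      (h.isClosed_halfPlane j).isOpen_compl.mem_nhds (h.not_mem_of_ne ht hij)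
  filter_upwards [h1.filter_mono nhdsWithin_le_nhds, self_mem_nhdsWithin] with x hx hxS
  obtain ⟨j, hj⟩ := mem_iUnion.1 hxS
  by_cases hij : i = j
  · rwa [hij]
  · exact absurd hj (hx j hij)

lemma planePoint_notMem_iface (h : JunctionFrame e0 e) {i : Fin N} {s t : ℝ} (ht : 0 < t) :
    planePoint e0 (e i) s t ∉ iface e0 := by
  rintro ⟨r, hr⟩
  have := congrArg (fun x => ⟪x, e i⟫) hr
  simp only [h.inner_planePoint_e, real_inner_smul_left, h.orth', mul_zero, abs_of_pos ht] at this
  exact ht.ne' this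

section Viscosity

variable {A : Type} [MetricSpace A] {Ai : Fin N → Set A} {f : Fin N → E3 → A → E3}
  {ℓ : Fin N → E3 → A → ℝ} {lam : ℝ} {u v : E3 → ℝ}

lemma subSol_of_touchAbove (h : JunctionFrame e0 e) (hu : IsSubSol N e0 e Ai f ℓ lam u) {i : Fin N}
    {s t p q C : ℝ} (ht : 0 < t)
    (hT : TouchAbove (fun s t => u (planePoint e0 (e i) s t)) s t p q C) {a : A} (ha : a ∈ Ai i) :
    lam * u (planePoint e0 (e i) s t) - p * ⟪f i (planePoint e0 (e i) s t) a, e0⟫ -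
      q * ⟪f i (planePoint e0 (e i) s t) a, e i⟫ - ℓ i (planePoint e0 (e i) s t) a ≤ 0 := by
  have := hu _ (planePoint_mem e0 e i s t)
    (h.quadTest (p - 2 * C * s) (fun _ => q - 2 * C * t) C) ?_ i
    (planePoint_mem_halfPlane _ _ _ _) a ha (Or.inl (h.planePoint_notMem_iface ht))
  · rw [h.inner_quadTest, abs_of_pos ht] at this
    linarith
  · filter_upwards [(h.eventually_halfPlane i ht.le hT).filter_mono nhdsWithin_le_nhds,
      h.eventually_mem_halfPlane ht] with x hx hxi
    have h0 := h.inner_nonneg hxi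
    have h1 := hx h0
    rw [← h.planePoint_inner hxi, h.quadTest_planePoint, h.quadTest_planePoint, abs_of_nonneg h0,
      abs_of_pos ht]
    linarith

lemma subSol_of_touchAbove_iface (h : JunctionFrame e0 e) (hu : IsSubSol N e0 e Ai f ℓ lam u)
    {s p C : ℝ} {q : Fin N → ℝ}
    (hT : ∀ j, TouchAbove (fun s t => u (planePoint e0 (e j) s t)) s 0 p (q j) C) {i : Fin N}
    {a : A} (ha : a ∈ Ai i) (hc : 0 ≤ ⟪f i (planePoint e0 (e i) s 0) a, e i⟫) :
    lam * u (planePoint e0 (e i) s 0) - p * ⟪f i (planePoint e0 (e i) s 0) a, e0⟫ -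
      q i * ⟪f i (planePoint e0 (e i) s 0) a, e i⟫ - ℓ i (planePoint e0 (e i) s 0) a ≤ 0 := by
  have := hu _ (planePoint_mem e0 e i s 0) (h.quadTest (p - 2 * C * s) q C) ?_ i
    (planePoint_mem_halfPlane _ _ _ _) a ha (Or.inr hc)
  · rw [h.inner_quadTest, abs_zero] at this
    linarith
  · have hT' : ∀ᶠ x in 𝓝 (planePoint e0 (e i) s 0), ∀ j, _ := eventually_all.2 fun j => by
      have := h.eventually_halfPlane j le_rfl (hT j)
      rw [planePoint_zero] at this ⊢
      exact this
    filter_upwards [hT'.filter_mono nhdsWithin_le_nhds, self_mem_nhdsWithin] with x hx hxS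
    obtain ⟨j, hj⟩ := mem_iUnion.1 hxS
    have h0 := h.inner_nonneg hj
    have h1 := hx j h0
    have h2 : planePoint e0 (e i) s 0 = planePoint e0 (e j) s 0 := by simp only [planePoint_zero]
    rw [← h.planePoint_inner hj, h2, h.quadTest_planePoint, h.quadTest_planePoint,
      abs_of_nonneg h0, abs_zero]
    linarith

lemma superSol_of_touchBelow (h : JunctionFrame e0 e) (hv : IsSuperSol N e0 e Ai f ℓ lam v)
    {i : Fin N} {s t p q C : ℝ} (ht : 0 < t)
    (hT : TouchBelow (fun s t => v (planePoint e0 (e i) s t)) s t p q C) :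
    ∃ a ∈ Ai i, 0 ≤ lam * v (planePoint e0 (e i) s t) -
      p * ⟪f i (planePoint e0 (e i) s t) a, e0⟫ - q * ⟪f i (planePoint e0 (e i) s t) a, e i⟫ -
      ℓ i (planePoint e0 (e i) s t) a := by
  have hmin : IsLocalMinOn (fun y => v y -
      (h.quadTest (p - 2 * (-C) * s) (fun _ => q - 2 * (-C) * t) (-C)).φ y) (junction N e0 e)
      (planePoint e0 (e i) s t) := by
    filter_upwards [(h.eventually_halfPlane i ht.le hT).filter_mono nhdsWithin_le_nhds,
      h.eventually_mem_halfPlane ht] with x hx hxi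
    have h0 := h.inner_nonneg hxi
    have h1 := hx h0
    rw [← h.planePoint_inner hxi, h.quadTest_planePoint, h.quadTest_planePoint, abs_of_nonneg h0,
      abs_of_pos ht]
    linarith
  obtain ⟨j, hj, a, ha, -, hle⟩ := hv _ (planePoint_mem e0 e i s t) _ hmin
  obtain rfl : i = j := by
    by_contra hij
    exact h.not_mem_of_ne ht hij hj
  refine ⟨a, ha, ?_⟩
  rw [h.inner_quadTest, abs_of_pos ht] at hle
  linarith

lemma superSol_of_touchBelow_iface (h : JunctionFrame e0 e) (hv : IsSuperSol N e0 e Ai f ℓ lam v)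
    {s p C : ℝ} {q : Fin N → ℝ} (hx : s • e0 ∈ junction N e0 e)
    (hT : ∀ j, TouchBelow (fun s t => v (planePoint e0 (e j) s t)) s 0 p (q j) C) :
    ∃ i, ∃ a ∈ Ai i, 0 ≤ lam * v (planePoint e0 (e i) s 0) -
      p * ⟪f i (planePoint e0 (e i) s 0) a, e0⟫ - q i * ⟪f i (planePoint e0 (e i) s 0) a, e i⟫ -
      ℓ i (planePoint e0 (e i) s 0) a := by
  have hmin : IsLocalMinOn (fun y => v y - (h.quadTest (p - 2 * (-C) * s) q (-C)).φ y)
      (junction N e0 e) (s • e0) := by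
    have hT' : ∀ᶠ x in 𝓝 (s • e0), ∀ j, _ := eventually_all.2 fun j => by
      have := h.eventually_halfPlane j le_rfl (hT j)
      rw [planePoint_zero] at this
      exact this
    filter_upwards [hT'.filter_mono nhdsWithin_le_nhds, self_mem_nhdsWithin] with x hx hxS
    obtain ⟨j, hj⟩ := mem_iUnion.1 hxS
    have h0 := h.inner_nonneg hj
    have h1 := hx j h0
    rw [← h.planePoint_inner hj, ← planePoint_zero e0 (e j), h.quadTest_planePoint,
      h.quadTest_planePoint, abs_of_nonneg h0, abs_zero]
    linarith
  obtain ⟨i, -, a, ha, -, hle⟩ := hv _ hx _ hmin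
  refine ⟨i, a, ha, ?_⟩
  rw [← planePoint_zero e0 (e i), h.inner_quadTest, abs_zero] at hle
  linarith

end Viscosity

end JunctionFrame

lemma TouchAbove.add_sqrt {W : ℝ → ℝ → ℝ} {κ s t p q C : ℝ} (hκ : 0 ≤ κ)
    (h : TouchAbove (fun s t => W s t - κ * √(1 + s ^ 2 + t ^ 2)) s t p q C) :
    TouchAbove W s t (p + κ * (s / √(1 + s ^ 2 + t ^ 2))) (q + κ * (t / √(1 + s ^ 2 + t ^ 2)))
      (C + κ * (1 / (2 * √(1 + s ^ 2 + t ^ 2)))) := by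
  have hsq : √(1 + s ^ 2 + t ^ 2) ^ 2 = 1 + s ^ 2 + t ^ 2 := Real.sq_sqrt (by positivity)
  have hn : 0 < √(1 + s ^ 2 + t ^ 2) := by positivity
  set n := √(1 + s ^ 2 + t ^ 2) with hndef
  filter_upwards [h] with z hz hz0
  have hz1 := hz hz0
  have h1 : √(1 + z.1 ^ 2 + z.2 ^ 2) ≤ ((1 + z.1 ^ 2 + z.2 ^ 2) + n ^ 2) / (2 * n) := by
    rw [le_div_iff₀ (by positivity)]
    have h := Real.sq_sqrt (show 0 ≤ 1 + z.1 ^ 2 + z.2 ^ 2 by positivity)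
    nlinarith [sq_nonneg (√(1 + z.1 ^ 2 + z.2 ^ 2) - n)]
  have h2 : ((1 + z.1 ^ 2 + z.2 ^ 2) + n ^ 2) / (2 * n) = n + s / n * (z.1 - s) +
      t / n * (z.2 - t) + 1 / (2 * n) * ((z.1 - s) ^ 2 + (z.2 - t) ^ 2) := by
    field_simp
    linear_combination -hsq
  have h3 := mul_le_mul_of_nonneg_left (h1.trans_eq h2) hκ
  linarith

lemma abs_sqrt_sub_sqrt_le (s t t' : ℝ) :
    |√(1 + s ^ 2 + t ^ 2) - √(1 + s ^ 2 + t' ^ 2)| ≤ |t - t'| := by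
  have key : ∀ t t' : ℝ, √(1 + s ^ 2 + t ^ 2) ≤ √(1 + s ^ 2 + t' ^ 2) + |t - t'| := by
    intro t t'
    refine Real.sqrt_le_iff.2 ⟨by positivity, ?_⟩
    have h1 := Real.sq_sqrt (show 0 ≤ 1 + s ^ 2 + t' ^ 2 by positivity)
    have h2 : |t'| ≤ √(1 + s ^ 2 + t' ^ 2) := Real.abs_le_sqrt (by linarith [sq_nonneg s])
    have h3 : t' * (t - t') ≤ √(1 + s ^ 2 + t' ^ 2) * |t - t'| :=
      (le_abs_self _).trans (by rw [abs_mul]; gcongr)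
    have h4 := sq_abs (t - t')
    nlinarith
  rw [abs_le]
  have h1 := key t t'
  have h2 := key t' t
  rw [abs_sub_comm] at h2
  constructor <;> linarith

/-- The difference of the two solutions has a maximum if it is small far away. -/
lemma CoordProblem.exists_isMax {N : ℕ} {A : Type} {Ai : Fin N → Set A}
    {b c l : Fin N → ℝ → ℝ → A → ℝ} {lam c₀ Mf L : ℝ} {U V : Fin N → ℝ → ℝ → ℝ}
    (h : CoordProblem Ai b c l lam c₀ Mf L U V) [Nonempty (Fin N)] {ρ : ℝ} (hρ : 0 ≤ ρ)
    (hout : ∀ j s t, 0 ≤ t → ρ < |s| ∨ ρ < t → U j s t - V j s t ≤ U j 0 0 - V j 0 0) :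
    ∃ i s₀ t₀, 0 ≤ t₀ ∧ ∀ j s t, 0 ≤ t → U j s t - V j s t ≤ U i s₀ t₀ - V i s₀ t₀ := by
  set B : Set (ℝ × ℝ) := closedBall 0 ρ ×ˢ Icc 0 ρ with hB
  have hBmem : ∀ z, z ∈ B ↔ |z.1| ≤ ρ ∧ 0 ≤ z.2 ∧ z.2 ≤ ρ := fun z => by
    simp [hB]
  have hBc : IsCompact B := (isCompact_closedBall _ _).prod isCompact_Icc
  have hcen : ((0, 0) : ℝ × ℝ) ∈ B := (hBmem _).2 (by simpa using hρ)
  have hex : ∀ j, ∃ z ∈ B, ∀ w ∈ B,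
      U j w.1 w.2 - V j w.1 w.2 ≤ U j z.1 z.2 - V j z.1 z.2 := fun j => by
    have husc := h.usc_diff j (X := ℝ × ℝ) continuous_id continuous_id (P := fun _ => 0)
      continuous_const
    obtain ⟨z, hz, hm⟩ := (husc.upperSemicontinuousOn B).exists_isMaxOn ⟨_, hcen⟩ hBc
    exact ⟨z, hz, fun w hw => by
      simpa only [mem_ofPred_eq, id, sub_zero] using hm hw⟩
  choose z hzB hz using hex
  obtain ⟨i, hi⟩ := Finite.exists_max fun j => U j (z j).1 (z j).2 - V j (z j).1 (z j).2
  refine ⟨i, (z i).1, (z i).2, ((hBmem _).1 (hzB i)).2.1, fun j s t ht => ?_⟩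
  refine le_trans ?_ (hi j)
  by_cases hst : (s, t) ∈ B
  · exact hz j _ hst
  · refine (hout j s t ht ?_).trans (hz j _ hcen)
    by_contra! hcon
    exact hst ((hBmem _).2 ⟨hcon.1, ht, hcon.2⟩)

namespace JunctionFrame

variable {N : ℕ} {e0 : E3} {e : Fin N → E3} {A : Type} {Ai : Fin N → Set A}
  {f : Fin N → E3 → A → E3} {ℓ : Fin N → E3 → A → ℝ}

lemma tendsto_planePoint (e0 : E3) (e : Fin N → E3) (i : Fin N) (z : ℝ × ℝ) :
    Tendsto (fun z : ℝ × ℝ => planePoint e0 (e i) z.1 z.2) (𝓝 z)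
      (𝓝[junction N e0 e] (planePoint e0 (e i) z.1 z.2)) :=
  tendsto_nhdsWithin_iff.2 ⟨(continuous_planePoint e0 (e i)).tendsto z,
    Eventually.of_forall fun _ => planePoint_mem e0 e i _ _⟩

/-- Full controllability on the interface gives coercivity of the Hamiltonian in a neighborhood. -/
lemma exists_coercive_control (h : JunctionFrame e0 e) {δ Lf : ℝ} (hδ : 0 < δ)
    (hflip : ∀ k, ∀ x ∈ halfPlane e0 (e k), ∀ y ∈ halfPlane e0 (e k), ∀ a ∈ Ai k,
      ‖f k x a - f k y a‖ ≤ Lf * ‖x - y‖)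
    (hctrl : ∀ k, ∀ x ∈ iface e0, ∀ w : E3, ‖w‖ < δ →
      (∃ c0 ci : ℝ, w = c0 • e0 + ci • e k) → ∃ a ∈ Ai k, f k x a = w)
    (i : Fin N) (s p q : ℝ) {t : ℝ} (ht : 0 ≤ t) (htδ : |Lf| * t ≤ δ / 4) :
    ∃ a ∈ Ai i, p * ⟪f i (planePoint e0 (e i) s t) a, e0⟫ +
      q * ⟪f i (planePoint e0 (e i) s t) a, e i⟫ ≤ -(δ / 4) * √(p ^ 2 + q ^ 2) ∧
      (t = 0 → q ≤ 0 → 0 ≤ ⟪f i (planePoint e0 (e i) s t) a, e i⟫) := by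
  set n := √(p ^ 2 + q ^ 2) with hn
  have hn0 : 0 ≤ n := Real.sqrt_nonneg _
  set z : E3 := p • e0 + q • e i with hz
  have hzn : ‖z‖ = n := by
    rw [hn, ← h.norm_smul_add_smul_sq i p q, Real.sqrt_sq (norm_nonneg _)]
  set r := δ / 2 * n⁻¹ with hr
  have hr0 : 0 ≤ r := by positivity
  have hrn : r * n ≤ δ / 2 := by
    rw [hr, mul_assoc]
    exact mul_le_of_le_one_right (by positivity) (inv_mul_le_one)
  have hrn2 : r * n ^ 2 = δ / 2 * n := by
    rcases hn0.eq_or_lt with h0 | h0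
    · simp [← h0]
    · rw [hr]
      field_simp
  obtain ⟨a, ha, hfa⟩ := hctrl i (s • e0) ⟨s, rfl⟩ (-r • z)
    (by
      rw [norm_smul, norm_neg, Real.norm_eq_abs, abs_of_nonneg hr0, hzn]
      linarith)
    ⟨-r * p, -r * q, by rw [hz, smul_add, smul_smul, smul_smul]⟩
  refine ⟨a, ha, ?_, ?_⟩
  · set w := f i (planePoint e0 (e i) s t) a with hw
    have hdiff : ‖w - -r • z‖ ≤ δ / 4 := by
      rw [← hfa, ← planePoint_zero e0 (e i) s]
      refine (hflip i _ (planePoint_mem_halfPlane _ _ _ _) _ (planePoint_mem_halfPlane _ _ _ _)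
        a ha).trans (le_trans ?_ htδ)
      have h1 := h.norm_planePoint_sub_le i s t s 0
      rw [sub_self, abs_zero, zero_add, sub_zero, abs_of_nonneg ht] at h1
      gcongr
      exact le_abs_self _
    have h1 : p * ⟪w, e0⟫ + q * ⟪w, e i⟫ = ⟪w - -r • z, z⟫ - r * n ^ 2 := by
      rw [inner_sub_left, real_inner_smul_left, real_inner_self_eq_norm_sq, hzn, hz,
        inner_add_right, real_inner_smul_right, real_inner_smul_right]
      ring
    have h2 : ⟪w - -r • z, z⟫ ≤ δ / 4 * n := by
      refine (real_inner_le_norm _ _).trans ?_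
      rw [hzn]
      gcongr
    rw [h1, hrn2]
    linarith
  · rintro rfl hq
    rw [planePoint_zero, hfa, real_inner_smul_left, hz, inner_add_left, real_inner_smul_left,
      real_inner_smul_left, h.orth', h.inner_e_self]
    have := mul_nonneg hr0 (neg_nonneg.2 hq)
    linarith

/-- Uniform continuity of a jointly continuous function in the coordinates of the half-planes. -/
lemma exists_uniform_modulus [MetricSpace A] [Nonempty (Fin N)] (hAcp : ∀ k, IsCompact (Ai k))
    (hlcont : ∀ k, ContinuousOn (fun q : E3 × A => ℓ k q.1 q.2)
      ((halfPlane e0 (e k)) ×ˢ (Ai k))) (R : ℝ) {η : ℝ} (hη : 0 < η) :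
    ∃ d > 0, ∀ i s t s' t', |s| ≤ R → |s'| ≤ R → 0 ≤ t → t ≤ R →
      0 ≤ t' → t' ≤ R → |s - s'| < d → |t - t'| < d → ∀ a ∈ Ai i,
      |ℓ i (planePoint e0 (e i) s t) a - ℓ i (planePoint e0 (e i) s' t') a| ≤ η := by
  have hone : ∀ i, ∃ d > 0, ∀ s t s' t', |s| ≤ R → |s'| ≤ R → 0 ≤ t → t ≤ R →
      0 ≤ t' → t' ≤ R → |s - s'| < d → |t - t'| < d → ∀ a ∈ Ai i,
      |ℓ i (planePoint e0 (e i) s t) a - ℓ i (planePoint e0 (e i) s' t') a| ≤ η := by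
    intro i
    have hK : IsCompact ((closedBall (0 : ℝ) R ×ˢ Icc 0 R) ×ˢ Ai i) :=
      ((isCompact_closedBall _ _).prod isCompact_Icc).prod (hAcp i)
    have hc : ContinuousOn (fun z : (ℝ × ℝ) × A => ℓ i (planePoint e0 (e i) z.1.1 z.1.2) z.2)
        ((closedBall (0 : ℝ) R ×ˢ Icc 0 R) ×ˢ Ai i) :=
      (hlcont i).comp (f := fun z : (ℝ × ℝ) × A => (planePoint e0 (e i) z.1.1 z.1.2, z.2))
        (Continuous.continuousOn
          (((continuous_planePoint e0 (e i)).comp continuous_fst).prodMk continuous_snd))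
        fun z hz => ⟨planePoint_mem_halfPlane _ _ _ _, hz.2⟩
    obtain ⟨d, hd, hdK⟩ := Metric.uniformContinuousOn_iff.1
      (hK.uniformContinuousOn_of_continuous hc) η hη
    refine ⟨d, hd, fun s t s' t' h1 h2 h3 h4 h5 h6 h7 h8 a ha => ?_⟩
    have := hdK ((s, t), a) ⟨⟨by simpa using h1, h3, h4⟩, ha⟩
      ((s', t'), a) ⟨⟨by simpa using h2, h5, h6⟩, ha⟩
      (by simp [Prod.dist_eq, Real.dist_eq, h7, h8])
    exact this.le
  choose d hd hdK using hone
  obtain ⟨k, hk⟩ := Finite.exists_min d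
  exact ⟨d k, hd k, fun i s t s' t' h1 h2 h3 h4 h5 h6 h7 h8 =>
    hdK i s t s' t' h1 h2 h3 h4 h5 h6 (h7.trans_le (hk i)) (h8.trans_le (hk i))⟩

/-- The coordinate form of the equation, for a subsolution penalized at infinity. -/
lemma coordProblem (h : JunctionFrame e0 e) [MetricSpace A] [Nonempty (Fin N)]
    (hAcp : ∀ k, IsCompact (Ai k))
    {Mf Lf lam κ : ℝ} (hMf : 0 ≤ Mf) (hlam : 0 < lam) (hκ : 0 ≤ κ)
    (hfbdd : ∀ k, ∀ x ∈ halfPlane e0 (e k), ∀ a ∈ Ai k, ‖f k x a‖ ≤ Mf)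
    (hflip : ∀ k, ∀ x ∈ halfPlane e0 (e k), ∀ y ∈ halfPlane e0 (e k), ∀ a ∈ Ai k,
      ‖f k x a - f k y a‖ ≤ Lf * ‖x - y‖)
    (hlcont : ∀ k, ContinuousOn (fun q : E3 × A => ℓ k q.1 q.2)
      ((halfPlane e0 (e k)) ×ˢ (Ai k)))
    {u v : E3 → ℝ} (hucont : ContinuousOn u (junction N e0 e))
    (hu : IsSubSol N e0 e Ai f ℓ lam u) (hvlsc : LowerSemicontinuousOn v (junction N e0 e))
    (hv : IsSuperSol N e0 e Ai f ℓ lam v) :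
    CoordProblem Ai (fun i s t a => ⟪f i (planePoint e0 (e i) s t) a, e0⟫)
      (fun i s t a => ⟪f i (planePoint e0 (e i) s t) a, e i⟫)
      (fun i s t a => ℓ i (planePoint e0 (e i) s t) a) lam (2 * κ * Mf) Mf |Lf|
      (fun i s t => u (planePoint e0 (e i) s t) - κ * √(1 + s ^ 2 + t ^ 2))
      (fun i s t => v (planePoint e0 (e i) s t)) := by
  have hin : ∀ (w w' : E3), ‖w'‖ = 1 → |⟪w, w'⟫| ≤ ‖w‖ := fun w w' hw' => by
    simpa [hw'] using abs_real_inner_le_norm w w'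
  have hbdd : ∀ i (w : E3), ‖w‖ = 1 → ∀ s t, ∀ a ∈ Ai i,
      |⟪f i (planePoint e0 (e i) s t) a, w⟫| ≤ Mf := fun i w hw s t a ha =>
    (hin _ _ hw).trans (hfbdd i _ (planePoint_mem_halfPlane _ _ _ _) a ha)
  have hlip : ∀ i (w : E3), ‖w‖ = 1 → ∀ s t s' t', ∀ a ∈ Ai i,
      |⟪f i (planePoint e0 (e i) s t) a, w⟫ - ⟪f i (planePoint e0 (e i) s' t') a, w⟫| ≤
        |Lf| * (|s - s'| + |t - t'|) := fun i w hw s t s' t' a ha => by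
    rw [← inner_sub_left]
    refine (hin _ _ hw).trans ((hflip i _ (planePoint_mem_halfPlane _ _ _ _) _
      (planePoint_mem_halfPlane _ _ _ _) a ha).trans ?_)
    gcongr
    · exact le_abs_self _
    · exact h.norm_planePoint_sub_le i s t s' t'
  refine
    { lam_pos := hlam
      Mf_nonneg := hMf
      L_nonneg := abs_nonneg _
      U_cont := fun i => ?_
      V_lsc := fun i z y hy => (tendsto_planePoint e0 e i z).eventually
        (hvlsc _ (planePoint_mem e0 e i z.1 z.2) y hy)
      U_glue := fun i j s => by simp only [planePoint_zero]
      V_glue := fun i j s => by simp only [planePoint_zero]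
      b_bdd := fun i s t _ => hbdd i e0 h.norm_e0 s t
      c_bdd := fun i s t _ => hbdd i (e i) (h.norm_e i) s t
      b_lip := fun i s t s' t' _ _ => hlip i e0 h.norm_e0 s t s' t'
      c_lip := fun i s t s' t' _ _ => hlip i (e i) (h.norm_e i) s t s' t'
      l_unif := fun R η hη => exists_uniform_modulus hAcp hlcont R hη
      sub_int := fun i s t ht p q C hT a ha => ?_
      super_int := fun i s t ht p q C hT => h.superSol_of_touchBelow hv ht hT
      super_iface := fun s p q C hT => h.superSol_of_touchBelow_iface hv ?_ hT }
  · refine Continuous.sub ?_ (by fun_prop)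
    exact continuous_iff_continuousAt.2 fun z =>
      (hucont _ (planePoint_mem e0 e i z.1 z.2)).tendsto.comp (tendsto_planePoint e0 e i z)
  · have h1 := h.subSol_of_touchAbove hu ht (TouchAbove.add_sqrt hκ hT) ha
    have hdiv : ∀ x, |x| ≤ √(1 + s ^ 2 + t ^ 2) → ∀ y, |y| ≤ Mf →
        κ * (x / √(1 + s ^ 2 + t ^ 2)) * y ≤ κ * Mf := fun x hx y hy => by
      have h2 : |x / √(1 + s ^ 2 + t ^ 2)| ≤ 1 := by
        rw [abs_div, abs_of_nonneg (Real.sqrt_nonneg _)]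
        exact div_le_one_of_le₀ hx (Real.sqrt_nonneg _)
      rw [mul_assoc]
      refine mul_le_mul_of_nonneg_left ((le_abs_self _).trans ?_) hκ
      rw [abs_mul]
      exact (mul_le_of_le_one_left (abs_nonneg _) h2).trans hy
    have h2 := hdiv s (Real.abs_le_sqrt (by linarith [sq_nonneg t])) _
      (hbdd i e0 h.norm_e0 s t a ha)
    have h3 := hdiv t (Real.abs_le_sqrt (by linarith [sq_nonneg s])) _
      (hbdd i (e i) (h.norm_e i) s t a ha)
    have h4 : 0 ≤ lam * (κ * √(1 + s ^ 2 + t ^ 2)) := by positivity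
    linarith
  · obtain ⟨i⟩ := ‹Nonempty (Fin N)›
    rw [← planePoint_zero e0 (e i)]
    exact planePoint_mem e0 e i s 0

end JunctionFrame

/-- Comparison principle under full controllability: a bounded continuous
subsolution is below any bounded lsc supersolution. -/
theorem stmt_18
    (N : ℕ) (hN : 2 ≤ N) (e0 : E3) (e : Fin N → E3)
    (he0 : ‖e0‖ = 1) (he : ∀ k, ‖e k‖ = 1)
    (heinj : Function.Injective e) (hee0 : ∀ k, e k ≠ e0)
    (horth : ∀ k, ⟪e k, e0⟫ = 0)
    {A : Type} [MetricSpace A] (Ai : Fin N → Set A)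
    (hAne : ∀ k, (Ai k).Nonempty) (hAcp : ∀ k, IsCompact (Ai k))
    (hAdisj : ∀ k l, k ≠ l → Disjoint (Ai k) (Ai l))
    (f : Fin N → E3 → A → E3) (Mf Lf : ℝ)
    (hfcont : ∀ k, ContinuousOn (fun q : E3 × A => f k q.1 q.2)
      ((halfPlane e0 (e k)) ×ˢ (Ai k)))
    (hfplane : ∀ k, ∀ x ∈ halfPlane e0 (e k), ∀ a ∈ Ai k,
      ∃ c0 ci : ℝ, f k x a = c0 • e0 + ci • e k)
    (hfbdd : ∀ k, ∀ x ∈ halfPlane e0 (e k), ∀ a ∈ Ai k, ‖f k x a‖ ≤ Mf)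
    (hflip : ∀ k, ∀ x ∈ halfPlane e0 (e k), ∀ y ∈ halfPlane e0 (e k), ∀ a ∈ Ai k,
      ‖f k x a - f k y a‖ ≤ Lf * ‖x - y‖)
    (ℓ : Fin N → E3 → A → ℝ) (Mℓ : ℝ) (ω : ℝ → ℝ)
    (hωmono : Monotone ω) (hω0 : ω 0 = 0)
    (hlcont : ∀ k, ContinuousOn (fun q : E3 × A => ℓ k q.1 q.2)
      ((halfPlane e0 (e k)) ×ˢ (Ai k)))
    (hlbdd : ∀ k, ∀ x ∈ halfPlane e0 (e k), ∀ a ∈ Ai k, |ℓ k x a| ≤ Mℓ)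
    (hlmod : ∀ k, ∀ x ∈ halfPlane e0 (e k), ∀ y ∈ halfPlane e0 (e k), ∀ a ∈ Ai k,
      |ℓ k x a - ℓ k y a| ≤ ω ‖x - y‖)
    (hH2 : ∀ k, ∀ x ∈ halfPlane e0 (e k),
      Convex ℝ {q : E3 × ℝ | ∃ a ∈ Ai k, q = (f k x a, ℓ k x a)})
    (δ : ℝ) (hδ : 0 < δ)
    (hH3 : ∀ k, ∀ x ∈ iface e0, ∀ w : E3, ‖w‖ < δ →
      (∃ c0 ci : ℝ, w = c0 • e0 + ci • e k) → ∃ a ∈ Ai k, f k x a = w)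
    (lam : ℝ) (hlam : 0 < lam)
    (u : E3 → ℝ) (hucont : ContinuousOn u (junction N e0 e))
    (Mu : ℝ) (hMu : ∀ x ∈ junction N e0 e, |u x| ≤ Mu)
    (hu : IsSubSol N e0 e Ai f ℓ lam u)
    (v : E3 → ℝ) (hvlsc : LowerSemicontinuousOn v (junction N e0 e))
    (Mv : ℝ) (hMv : ∀ x ∈ junction N e0 e, |v x| ≤ Mv)
    (hv : IsSuperSol N e0 e Ai f ℓ lam v) :
    ∀ x ∈ junction N e0 e, u x ≤ v x := by
  have hF : JunctionFrame e0 e := ⟨he0, he, heinj, horth⟩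
  set k : Fin N := ⟨0, by omega⟩
  have : Nonempty (Fin N) := ⟨k⟩
  have hpt := JunctionFrame.planePoint_mem e0 e
  have hplane : ∀ i s t, planePoint e0 (e i) s t ∈ halfPlane e0 (e i) := fun i =>
    planePoint_mem_halfPlane e0 (e i)
  obtain ⟨a₀, ha₀⟩ := hAne k
  have hMf0 : 0 ≤ Mf := (norm_nonneg _).trans (hfbdd k _ (hplane k 0 0) a₀ ha₀)
  have hMl0 : 0 ≤ Mℓ := (abs_nonneg _).trans (hlbdd k _ (hplane k 0 0) a₀ ha₀)
  have hMu0 : 0 ≤ Mu := (abs_nonneg _).trans (hMu _ (hpt k 0 0))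
  have hMv0 : 0 ≤ Mv := (abs_nonneg _).trans (hMv _ (hpt k 0 0))
  have hprob := fun κ (hκ : 0 ≤ κ) => hF.coordProblem hAcp hMf0 hlam hκ hfbdd hflip hlcont
    hucont hu hvlsc hv
  obtain ⟨τ, hτ, -, hLfτ⟩ := exists_small_mul_le (C := |Lf|) (η := δ / 4) (r := 1)
    (abs_nonneg _) (by positivity) one_pos
  obtain ⟨K, hK, hLip⟩ : ∃ K : ℝ, 0 ≤ K ∧ ∀ i s t t', 0 ≤ t → t ≤ τ / 2 → 0 ≤ t' → t' ≤ τ / 2 →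
      |u (planePoint e0 (e i) s t) - u (planePoint e0 (e i) s t')| ≤ K * |t - t'| := by
    have h0 := hprob 0 le_rfl
    refine exists_lipschitz_normal (U := fun i s t => u (planePoint e0 (e i) s t)) hlam
      (half_pos hτ) (δ₀ := δ / 4) (by positivity) hMu0 hMl0
      (fun i => by simpa using h0.U_cont i) (fun i j s => by simp only [planePoint_zero])
      (fun i s t _ => hMu _ (hpt i s t))
      (fun i s t _ a ha => hlbdd i _ (hplane i s t) a ha)
      (fun i s t ht p q C hT a ha => hF.subSol_of_touchAbove hu ht hT ha)
      (fun s p q C hT j a ha hc => hF.subSol_of_touchAbove_iface hu hT ha hc)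
      (fun i s t p q ht htτ => hF.exists_coercive_control hδ hflip hH3 i s p q ht
        (le_trans (by gcongr; linarith) hLfτ))
  intro x hx
  obtain ⟨j, hj⟩ := mem_iUnion.1 hx
  by_contra! hcon
  obtain ⟨κ, hκ, -, hκle⟩ := exists_small_mul_le
    (C := lam * √(1 + ⟪x, e0⟫ ^ 2 + ⟪x, e j⟫ ^ 2) + 2 * Mf) (η := lam * (u x - v x) / 2) (r := 1)
    (by positivity) (half_pos (mul_pos hlam (by linarith))) one_pos
  have h := hprob κ hκ.le
  set ρ := (2 * (Mu + Mv) + κ) / κ with hρ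
  have hρ0 : 0 ≤ ρ := by positivity
  have hκρ : κ * ρ = 2 * (Mu + Mv) + κ := mul_div_cancel₀ _ hκ.ne'
  obtain ⟨i, s₀, t₀, ht₀, hmax⟩ := h.exists_isMax hρ0 fun j s t ht hst => by
    have h1 := abs_le.1 (hMu _ (hpt j s t))
    have h2 := abs_le.1 (hMv _ (hpt j s t))
    have h3 := abs_le.1 (hMu _ (hpt j 0 0))
    have h4 := abs_le.1 (hMv _ (hpt j 0 0))
    have h5 : ρ ≤ √(1 + s ^ 2 + t ^ 2) := by
      rcases hst with hst | hst
      · exact hst.le.trans (Real.abs_le_sqrt (by linarith [sq_nonneg t]))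
      · exact hst.le.trans (Real.le_sqrt_of_sq_le (by linarith [sq_nonneg s]))
    have h6 := mul_le_mul_of_nonneg_left h5 hκ.le
    have h7 : √(1 + 0 ^ 2 + 0 ^ 2 : ℝ) = 1 := by norm_num
    rw [h7]
    linarith
  have hle := h.le_of_isMax (K := K + κ) (by positivity) (half_pos hτ) (fun i s t t' h0 h1 h2 h3 => by
    have e1 := abs_le.1 (hLip i s t t' h0 h1 h2 h3)
    have e2 := abs_le.1 (abs_sqrt_sub_sqrt_le s t t')
    have e3 := mul_le_mul_of_nonneg_left e2.1 hκ.le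
    have e4 := mul_le_mul_of_nonneg_left e2.2 hκ.le
    rw [abs_le]
    constructor <;> linarith) ht₀ hmax
  have hxle := mul_le_mul_of_nonneg_left (hmax j ⟪x, e0⟫ ⟪x, e j⟫ (hF.inner_nonneg hj)) hlam.le
  rw [hF.planePoint_inner hj] at hxle
  have hpos : 0 < lam * (u x - v x) := mul_pos hlam (by linarith)
  linarith
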